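/- Assume GRH. Let $0<\mu<1$, $\frac{2}{5}<\gamma<1<c<3$ with $c\neq 2$, let $B>0$, $C>0$, and let $\delta>0$ be sufficiently small. Then for all sufficiently large $X$ and all real $t$ with $|t|\le X^{(4\gamma-3c-1)/3-\delta}$, one has $\sum_{1<q\le (\log X)^{C}}\frac{1}{\varphi(q)}\sum^{*}_{\chi\ (\mathrm{mod}\ q)}\Big|\sum_{\mu X<n\le X}\Lambda(n)\chi(n)\big((n+1)^{\gamma}-n^{\gamma}\big)e(tn^{c})\Big|\ll \frac{X^{\gamma}}{(\log X)^{B}}$, with the implied constant depending only on $\mu,\gamma,c,B,C,\delta$. -/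

import Mathlib

open Finset
open scoped Classical

/-- `e(x) = e^{2πix}`. -/
noncomputable def e (x : ℝ) : ℂ := Complex.exp (2 * Real.pi * Complex.I * x)

/-- Generalized Riemann Hypothesis for Dirichlet L-functions: every zero `ρ` of every
Dirichlet `L`-function with `0 < Re ρ < 1` satisfies `Re ρ = 1/2`. -/
def GRH : Prop :=
  ∀ (N : ℕ) [NeZero N] (χ : DirichletCharacter ℂ N) (ρ : ℂ),
    χ.LFunction ρ = 0 → 0 < ρ.re → ρ.re < 1 → ρ.re = 1 / 2

theorem ZMod.sum_range_natCast {N : ℕ} [NeZero N] {M : Type*} [AddCommMonoid M] (f : ZMod N → M) :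
    ∑ k ∈ range N, f (k : ZMod N) = ∑ a : ZMod N, f a := by
  refine Finset.sum_bij' (fun k _ ↦ (k : ZMod N)) (fun a _ ↦ a.val) ?_ ?_ ?_ ?_ ?_
  · simp
  · intro a _; simpa using a.val_lt
  · intro k hk; exact ZMod.val_cast_of_lt (by simpa using hk)
  · intro a _; simp
  · simp

namespace DirichletCharacter

variable {N : ℕ} [NeZero N] {χ : DirichletCharacter ℂ N}

theorem norm_sum_range_le (hχ : χ ≠ 1) (m n : ℕ) :
    ‖∑ k ∈ range n, χ ((m + k : ℕ) : ZMod N)‖ ≤ N := by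
  induction n using Nat.strong_induction_on generalizing m with
  | _ n ih =>
    rcases lt_or_ge n N with hn | hn
    · calc ‖∑ k ∈ range n, χ ((m + k : ℕ) : ZMod N)‖ ≤ ∑ k ∈ range n, (1 : ℝ) :=
            norm_sum_le_of_le _ fun k _ ↦ χ.norm_le_one _
        _ ≤ N := by simpa using hn.le
    · have hN : 0 < N := NeZero.pos N
      obtain ⟨d, rfl⟩ := Nat.exists_eq_add_of_le hn
      rw [sum_range_add]
      have h0 : ∑ k ∈ range N, χ ((m + k : ℕ) : ZMod N) = 0 := by
        push_cast
        rw [ZMod.sum_range_natCast (fun a ↦ χ ((m : ZMod N) + a)),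
          Fintype.sum_equiv (Equiv.addLeft (m : ZMod N)) (fun a ↦ χ ((m : ZMod N) + a)) χ
            (fun _ ↦ rfl)]
        exact MulChar.sum_eq_zero_of_ne_one hχ
      rw [h0, zero_add]
      simpa [add_assoc] using ih d (by lia) (m + N)

theorem norm_sum_Icc_le (hχ : χ ≠ 1) (n : ℕ) : ‖∑ k ∈ Icc 1 n, χ (k : ZMod N)‖ ≤ N := by
  have h := Finset.sum_Ico_eq_sum_range (fun k ↦ χ (k : ZMod N)) 1 (n + 1)
  rw [Nat.add_sub_cancel, Finset.Ico_add_one_right_eq_Icc] at h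
  exact h ▸ norm_sum_range_le hχ 1 n

open MeasureTheory Asymptotics Filter Topology in
theorem norm_LFunction_le (hχ : χ ≠ 1) {s : ℂ} (hs : 0 < s.re) :
    ‖χ.LFunction s‖ ≤ N * ‖s‖ / s.re := by
  set A : ℝ → ℂ := fun t ↦ ∑ k ∈ Icc 1 ⌊t⌋₊, χ (k : ZMod N) with hA
  have hAle (t : ℝ) : ‖A t‖ ≤ N := norm_sum_Icc_le hχ _
  have hAm : Measurable A :=
    (measurable_from_nat (f := fun n ↦ ∑ k ∈ Icc 1 n, χ (k : ZMod N))).comp Nat.measurable_floor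
  set f : ℝ → ℂ := (Set.Ioi 1).indicator A with hf
  have hfle (t : ℝ) : ‖f t‖ ≤ N := (norm_indicator_le_norm_self _ _).trans (hAle t)
  have hfm : Measurable f := hAm.indicator measurableSet_Ioi
  have hfloc : LocallyIntegrable f :=
    (locallyIntegrable_const (N : ℝ)).mono hfm.aestronglyMeasurable
      (Eventually.of_forall fun t ↦ by simpa using hfle t)
  have hdiff (z : ℂ) (hz : 0 < z.re) : DifferentiableAt ℂ (mellin f) (-z) := by
    refine mellin_differentiableAt_of_isBigO_rpow (a := 0) (b := -z.re - 1)
      (hfloc.locallyIntegrableOn _) ?_ (by simpa) ?_ (by simp)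
    · simpa using! isBigO_of_le' (c := (N : ℝ)) atTop (g := fun _ : ℝ ↦ (1 : ℝ))
        (by simpa using hfle)
    · refine (EventuallyEq.trans_isBigO (f₂ := fun _ ↦ (0 : ℂ)) ?_ (isBigO_zero _ _))
      filter_upwards [Ioo_mem_nhdsGT (zero_lt_one : (0 : ℝ) < 1)] with t ht
      exact Set.indicator_of_notMem (by simpa using ht.2.le) _
  have hmell (z : ℂ) : mellin f (-z) = ∫ t in Set.Ioi (1 : ℝ), A t * (t : ℂ) ^ (-(z + 1)) := by
    have : ∀ t : ℝ, (t : ℂ) ^ (-z - 1) • f t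
        = (Set.Ioi (1 : ℝ)).indicator (fun t ↦ A t * (t : ℂ) ^ (-(z + 1))) t := by
      intro t
      by_cases ht : t ∈ Set.Ioi (1 : ℝ)
      · simp only [hf, Set.indicator_of_mem ht, smul_eq_mul]
        rw [mul_comm, neg_add']
      · simp only [hf, Set.indicator_of_notMem ht, smul_zero]
    simp only [mellin, this]
    rw [setIntegral_indicator measurableSet_Ioi]
    congr 2
    ext t
    simp only [Set.mem_inter_iff, Set.mem_Ioi]
    exact ⟨And.right, fun h ↦ ⟨zero_lt_one.trans h, h⟩⟩
  have hopen : IsOpen {z : ℂ | 0 < z.re} := isOpen_lt continuous_const Complex.continuous_re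
  have hEq : Set.EqOn χ.LFunction (fun z ↦ z * mellin f (-z)) {z : ℂ | 0 < z.re} := by
    refine AnalyticOnNhd.eqOn_of_preconnected_of_eventuallyEq (𝕜 := ℂ) (z₀ := 2) ?_ ?_ ?_ (by simp) ?_
    · exact (differentiable_LFunction hχ).differentiableOn.analyticOnNhd hopen
    · refine DifferentiableOn.analyticOnNhd (fun z hz ↦ ?_) hopen
      have hneg : DifferentiableAt ℂ (fun y : ℂ ↦ -y) z := by fun_prop
      exact (differentiableAt_fun_id.mul ((hdiff z hz).comp z hneg)).differentiableWithinAt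
    · exact (convex_halfSpace_re_gt (0 : ℝ)).isPreconnected
    · have : {z : ℂ | 1 < z.re} ∈ 𝓝 (2 : ℂ) :=
        (isOpen_lt continuous_const Complex.continuous_re).mem_nhds (by simp)
      filter_upwards [this] with z hz
      rw [hmell, LFunction_eq_LSeries _ hz]
      refine LSeries_eq_mul_integral _ le_rfl (zero_lt_one.trans hz)
        (LSeriesSummable_of_one_lt_re χ hz) ?_
      simpa using! isBigO_of_le' (c := (N : ℝ)) atTop (g := fun _ : ℕ ↦ (1 : ℝ))
        (by simpa using norm_sum_Icc_le hχ)
  rw [hEq hs]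
  simp only []
  rw [hmell, norm_mul, mul_comm (N : ℝ), mul_div_assoc]
  gcongr
  calc ‖∫ t in Set.Ioi (1 : ℝ), A t * (t : ℂ) ^ (-(s + 1))‖
      ≤ ∫ t in Set.Ioi (1 : ℝ), N * t ^ (-s.re - 1) := by
        refine norm_integral_le_of_norm_le
          ((integrableOn_Ioi_rpow_of_lt (by linarith) one_pos).const_mul _) ?_
        refine (ae_restrict_iff' measurableSet_Ioi).mpr (Eventually.of_forall fun t ht ↦ ?_)
        rw [norm_mul, Complex.norm_cpow_eq_rpow_re_of_pos (zero_lt_one.trans ht)]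
        have hre : (-(s + 1)).re = -s.re - 1 := by simp; ring
        have ht0 : (0 : ℝ) ≤ t := (zero_lt_one.trans ht).le
        rw [hre]
        gcongr
        exact hAle t
    _ = N / s.re := by
        rw [integral_const_mul, integral_Ioi_rpow_of_lt (by linarith) one_pos]
        simp [field]

theorem norm_LFunction_ge_of_re_eq_two (χ : DirichletCharacter ℂ N) {s : ℂ} (hs : s.re = 2) :
    1 / 4 ≤ ‖χ.LFunction s‖ := by
  rw [LFunction_eq_LSeries _ (by rw [hs]; norm_num)]
  have hsum : LSeriesSummable (χ ·) s := LSeriesSummable_of_one_lt_re χ (by rw [hs]; norm_num)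
  have hz : HasSum (fun n : ℕ ↦ 1 / (n : ℝ) ^ 2) (Real.pi ^ 2 / 6) := hasSum_zeta_two
  have hle (n : ℕ) : ‖LSeries.term (χ ·) s n‖ ≤ 1 / (n : ℝ) ^ 2 := by
    rcases eq_or_ne n 0 with rfl | hn
    · simp
    · rw [LSeries.norm_term_eq, if_neg hn, hs]
      norm_cast
      gcongr
      exact χ.norm_le_one _
  have hz2 := hz.summable.hasSum_iff.mpr rfl
  have h1 := hsum.sum_add_tsum_nat_add 2
  have h2 := hz.summable.sum_add_tsum_nat_add 2
  rw [hz.tsum_eq] at h2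
  simp only [sum_range_succ, range_zero, sum_empty, LSeries.term_zero, Nat.cast_zero] at h1 h2
  have h3 : LSeries.term (χ ·) s 1 = 1 := by simp
  have h4 : ‖∑' i, LSeries.term (χ ·) s (i + 2)‖ ≤ ∑' i : ℕ, 1 / ((i + 2 : ℕ) : ℝ) ^ 2 :=
    tsum_of_norm_bounded ((summable_nat_add_iff 2).mpr hz.summable).hasSum fun i ↦ hle _
  have h5 : Real.pi ^ 2 / 6 < 1.7 := by nlinarith [Real.pi_lt_d2, Real.pi_gt_three]
  rw [LSeries, ← h1, h3, zero_add]
  norm_num at h2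
  have h6 := norm_sub_le_norm_add (1 : ℂ) (∑' i, LSeries.term (χ ·) s (i + 2))
  rw [norm_one] at h6
  have h7 : ∑' i : ℕ, 1 / ((i + 2 : ℕ) : ℝ) ^ 2 = ∑' i : ℕ, (((i : ℝ) + 2) ^ 2)⁻¹ := by simp
  norm_num only at h5 ⊢
  linarith

end DirichletCharacter

namespace Complex

open Metric in
theorem norm_deriv_div_le_of_ne_zero {f : ℂ → ℂ} {c z : ℂ} {r R M : ℝ}
    (hr : 0 ≤ r) (hrR : r < R) (hM : 0 < M) (hf : DifferentiableOn ℂ f (ball c R))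
    (hf0 : ∀ w ∈ ball c R, f w ≠ 0)
    (hfM : ∀ w ∈ ball c R, Real.log ‖f w / f c‖ ≤ M) (hz : z ∈ closedBall c r) :
    ‖deriv f z / f z‖ ≤ 8 * R / (R - r) ^ 2 * M := by
  have hR : 0 < R := hr.trans_lt hrR
  have hc : c ∈ ball c R := mem_ball_self hR
  have hfd (w) (hw : w ∈ ball c R) : HasDerivAt f (deriv f w) w :=
    (hf.differentiableAt (isOpen_ball.mem_nhds hw)).hasDerivAt
  have hd : DifferentiableOn ℂ (fun w ↦ deriv f w / f w) (ball c R) :=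
    (hf.deriv isOpen_ball).div hf hf0
  obtain ⟨g₀, hg₀⟩ := hd.isExactOn_ball
  set g : ℂ → ℂ := fun w ↦ g₀ w - g₀ c with hg
  have hgd (w) (hw : w ∈ ball c R) : HasDerivAt g (deriv f w / f w) w := (hg₀ w hw).sub_const _
  have hexp (w) (hw : w ∈ ball c R) : f w / f c = exp (g w) := by
    have hder (y) (hy : y ∈ ball c R) : HasDerivAt (fun y ↦ f y * exp (-g y)) 0 y := by
      convert! (hfd y hy).mul (hgd y hy).neg.cexp using 1
      have := hf0 y hy
      simp only [Pi.neg_apply]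
      field_simp
      ring
    have := (convex_ball c R).is_const_of_fderivWithin_eq_zero (𝕜 := ℂ)
      (fun y hy ↦ (hder y hy).differentiableAt.differentiableWithinAt)
      (fun y hy ↦ by
        rw [fderivWithin_of_isOpen isOpen_ball hy, (hder y hy).hasFDerivAt.fderiv]
        ext; simp) hw hc
    simp only [hg, sub_self, neg_zero, exp_zero, mul_one] at this
    rw [← this, exp_neg, div_eq_iff (mul_ne_zero (hf0 w hw) (inv_ne_zero (exp_ne_zero _)))]
    have := exp_ne_zero (g₀ w - g₀ c)
    rw [hg]
    field_simp
  have hre (w) (hw : w ∈ ball c R) : (g w).re ≤ M := by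
    have := hfM w hw
    rwa [hexp w hw, norm_exp, Real.log_exp] at this
  set ρ := (R - r) / 2 with hρ
  have hρ0 : 0 < ρ := by rw [hρ]; linarith
  have hbound (w) (hw : w ∈ closedBall c (r + ρ)) : ‖g w‖ ≤ 2 * M * R / ρ := by
    have hwn : ‖w - c‖ ≤ r + ρ := by simpa [dist_eq] using hw
    have hlt : r + ρ < R := by rw [hρ]; linarith
    have := borelCaratheodory_zero (f := fun y ↦ g (y + c)) (R := R) (z := w - c) hM
      (fun y hy ↦ ?_) (fun y hy ↦ ?_) hR (by simpa using hwn.trans_lt hlt) (by simp [hg])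
    · simp only [sub_add_cancel] at this
      refine this.trans ?_
      gcongr
      · linarith
      · rw [hρ] at hwn ⊢; linarith
    · have : y + c ∈ ball c R := by simpa [dist_eq] using hy
      exact ((hgd _ this).differentiableAt.comp y
        (differentiableAt_id.add_const c)).differentiableWithinAt
    · exact hre _ (by simpa [dist_eq] using hy)
  have hzn : dist z c ≤ r := hz
  have hsub : closedBall z ρ ⊆ closedBall c (r + ρ) :=
    closedBall_subset_closedBall' (by linarith)
  have hzR : z ∈ ball c R := by rw [mem_ball]; linarith
  have hsubR : closedBall c (r + ρ) ⊆ ball c R := closedBall_subset_ball (by rw [hρ]; linarith)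
  rw [← (hgd z hzR).deriv]
  refine (norm_deriv_le_of_forall_mem_sphere_norm_le hρ0 (f := g) ?_
    fun w hw ↦ hbound w (hsub (sphere_subset_closedBall hw))).trans (le_of_eq ?_)
  · refine DifferentiableOn.diffContOnCl_ball (U := ball c R) (fun w hw ↦ ?_) (hsub.trans hsubR)
    exact (hgd w hw).differentiableAt.differentiableWithinAt
  · have : R - r ≠ 0 := by linarith
    rw [hρ]; field_simp; ring

end Complex

theorem GRH.norm_deriv_LFunction_div_le (hGRH : GRH) {N : ℕ} [NeZero N]
    {χ : DirichletCharacter ℂ N} (hχ : χ ≠ 1) {ε : ℝ} (hε : 0 < ε) (hε1 : ε ≤ 1) {s : ℂ}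
    (hs : 1 / 2 + ε ≤ s.re) (hs2 : s.re ≤ 2) :
    ‖deriv χ.LFunction s / χ.LFunction s‖ ≤ 12 / ε ^ 2 * Real.log (8 * N * (|s.im| + 4)) := by
  set c : ℂ := ⟨2, s.im⟩ with hc
  have hN : (1 : ℝ) ≤ N := by exact_mod_cast NeZero.one_le
  have hu : 0 ≤ |s.im| := abs_nonneg _
  have hre {w : ℂ} (hw : w ∈ Metric.ball c (3 / 2)) : 1 / 2 < w.re := by
    have h1 : ‖w - c‖ < 3 / 2 := by simpa [dist_eq_norm] using hw
    have h2 := (abs_le.mp ((Complex.abs_re_le_norm (w - c)).trans h1.le)).1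
    have h3 := (abs_lt.mp ((Complex.abs_re_le_norm (w - c)).trans_lt h1)).1
    simp only [Complex.sub_re, hc] at h3
    linarith
  have hne (w) (hw : w ∈ Metric.ball c (3 / 2)) : χ.LFunction w ≠ 0 := by
    intro h0
    rcases lt_or_ge w.re 1 with h1 | h1
    · have := hGRH N χ w h0 (by linarith [hre hw]) h1
      linarith [hre hw]
    · exact DirichletCharacter.LFunction_ne_zero_of_one_le_re χ (.inl hχ) h1 h0
  have hlog : 0 < Real.log (8 * N * (|s.im| + 4)) := Real.log_pos (by nlinarith)
  have key := Complex.norm_deriv_div_le_of_ne_zero (f := χ.LFunction) (c := c) (z := s)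
    (r := 3 / 2 - ε) (R := 3 / 2) (by linarith) (by linarith) hlog
    (DirichletCharacter.differentiable_LFunction hχ).differentiableOn hne (fun w hw ↦ ?_) ?_
  · convert key using 2
    ring
  · have hc4 := χ.norm_LFunction_ge_of_re_eq_two (s := c) rfl
    have hcpos : 0 < ‖χ.LFunction c‖ := by linarith
    refine Real.log_le_log (norm_pos_iff.mpr (div_ne_zero (hne w hw) (norm_pos_iff.mp hcpos))) ?_
    rw [norm_div, div_le_iff₀ hcpos]
    have hwre := hre hw
    have hwn : ‖w‖ ≤ |s.im| + 4 := by
      have h1 : ‖w - c‖ < 3 / 2 := by simpa [dist_eq_norm] using hw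
      have h2 : ‖c‖ ≤ 2 + |s.im| := by simpa [hc] using Complex.norm_le_abs_re_add_abs_im c
      have h3 := norm_add_le (w - c) c
      rw [sub_add_cancel] at h3
      linarith
    calc ‖χ.LFunction w‖ ≤ N * ‖w‖ / w.re :=
          DirichletCharacter.norm_LFunction_le hχ (by linarith)
      _ ≤ N * (|s.im| + 4) / (1 / 2) := by gcongr
      _ = 8 * N * (|s.im| + 4) * (1 / 4) := by ring
      _ ≤ _ := by gcongr
  · have : s - c = ((s.re - 2 : ℝ) : ℂ) := by apply Complex.ext <;> simp [hc]
    rw [Metric.mem_closedBall, dist_eq_norm, this, Complex.norm_real, Real.norm_eq_abs, abs_le]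
    constructor <;> linarith

/-! ### The bilateral Laplace transform -/

section BilateralLaplace

open MeasureTheory Complex FourierTransform Filter Topology

/-- The bilateral Laplace transform `s ↦ ∫ v, exp (s * v) * G v`. -/
noncomputable def bilateralLaplace (G : ℝ → ℂ) (s : ℂ) : ℂ := ∫ v : ℝ, exp (s * v) * G v

variable {G : ℝ → ℂ}

theorem bilateralLaplace_eq_fourier (G : ℝ → ℂ) (σ u : ℝ) :
    bilateralLaplace G (σ + u * I) =
      𝓕 (fun v : ℝ ↦ exp (σ * v) * G v) (-(2 * Real.pi)⁻¹ * u) := by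
  rw [Real.fourier_real_eq_integral_exp_smul, bilateralLaplace]
  congr 1
  ext v
  rw [smul_eq_mul, ← mul_assoc, ← Complex.exp_add]
  congr 2
  have : (Real.pi : ℂ) ≠ 0 := by exact_mod_cast Real.pi_ne_zero
  push_cast
  field_simp
  ring

theorem integrable_exp_mul (hG : Continuous G) (hc : HasCompactSupport G) (s : ℂ) :
    Integrable fun v : ℝ ↦ exp (s * v) * G v :=
  Continuous.integrable_of_hasCompactSupport (by fun_prop) hc.mul_left

theorem differentiable_bilateralLaplace (hG : Continuous G) (hc : HasCompactSupport G) :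
    Differentiable ℂ (bilateralLaplace G) := by
  intro s
  refine (hasDerivAt_integral_of_dominated_loc_of_deriv_le (μ := volume)
    (F := fun (z : ℂ) (v : ℝ) ↦ exp (z * v) * G v)
    (F' := fun z v ↦ v * exp (z * v) * G v)
    (bound := fun v ↦ |v| * Real.exp ((‖s‖ + 1) * |v|) * ‖G v‖)
    (Metric.ball_mem_nhds s one_pos) ?_ ?_ ?_ ?_ ?_ ?_).2.differentiableAt
  · exact Eventually.of_forall fun z ↦ (integrable_exp_mul hG hc z).aestronglyMeasurable
  · exact integrable_exp_mul hG hc s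
  · exact Continuous.aestronglyMeasurable (by fun_prop)
  · refine Eventually.of_forall fun v z hz ↦ ?_
    rw [norm_mul, norm_mul, Complex.norm_real, Real.norm_eq_abs, Complex.norm_exp]
    gcongr
    have h1 : ‖z‖ ≤ ‖s‖ + 1 := by
      have : ‖z - s‖ < 1 := by simpa [dist_eq_norm] using hz
      linarith [norm_le_norm_add_norm_sub' z s]
    calc (z * v).re ≤ ‖z * v‖ := re_le_norm _
      _ = ‖z‖ * |v| := by rw [norm_mul, Complex.norm_real, Real.norm_eq_abs]
      _ ≤ _ := by gcongr
  · exact Continuous.integrable_of_hasCompactSupport (by fun_prop) hc.norm.mul_left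
  · refine Eventually.of_forall fun v z _ ↦ ?_
    have h : HasDerivAt (fun z : ℂ ↦ z * v) v z := by
      simpa using (hasDerivAt_id z).mul_const (v : ℂ)
    simpa [mul_comm (v : ℂ)] using h.cexp.mul_const (G v)

theorem bilateralLaplace_deriv (hG : ContDiff ℝ 1 G) (hc : HasCompactSupport G) (s : ℂ) :
    bilateralLaplace (deriv G) s = -(s * bilateralLaplace G s) := by
  have hd : Continuous (deriv G) := hG.continuous_deriv le_rfl
  have h := integral_mul_deriv_eq_deriv_mul_of_integrable
    (u := fun v : ℝ ↦ exp (s * v)) (u' := fun v : ℝ ↦ s * exp (s * v)) (v := G) (v' := deriv G)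
    (fun x _ ↦ ?_) (fun x _ ↦ (hG.differentiable one_ne_zero x).hasDerivAt)
    (integrable_exp_mul hd hc.deriv s) ?_ (integrable_exp_mul hG.continuous hc s)
  · simp only [mul_assoc] at h
    rw [integral_const_mul] at h
    exact h
  · have h : HasDerivAt (fun x : ℝ ↦ s * x) s x := by
      simpa using (hasDerivAt_id x).ofReal_comp.const_mul s
    simpa [mul_comm s] using h.cexp
  · simpa [mul_assoc, Pi.mul_def] using (integrable_exp_mul hG.continuous hc s).const_mul s

theorem norm_bilateralLaplace_le (hG : Continuous G) (hc : HasCompactSupport G) {A : ℝ} {s : ℂ}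
    (hs : |s.re| ≤ A) : ‖bilateralLaplace G s‖ ≤ ∫ v : ℝ, Real.exp (A * |v|) * ‖G v‖ := by
  refine norm_integral_le_of_norm_le
    (Continuous.integrable_of_hasCompactSupport (by fun_prop) hc.norm.mul_left)
    (Eventually.of_forall fun v ↦ ?_)
  rw [norm_mul, Complex.norm_exp]
  gcongr
  calc (s * v).re = s.re * v := by simp
    _ ≤ |s.re * v| := le_abs_self _
    _ = |s.re| * |v| := abs_mul _ _
    _ ≤ _ := by gcongr

theorem exists_norm_pow_mul_bilateralLaplace_le (n : ℕ) (hG : ContDiff ℝ n G)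
    (hc : HasCompactSupport G) (A : ℝ) :
    ∃ C, ∀ s : ℂ, |s.re| ≤ A → ‖s‖ ^ n * ‖bilateralLaplace G s‖ ≤ C := by
  induction n generalizing G with
  | zero => exact ⟨_, fun s hs ↦ by simpa using norm_bilateralLaplace_le hG.continuous hc hs⟩
  | succ n ih =>
    obtain ⟨C, hC⟩ := ih (G := deriv G) (ContDiff.deriv' (by exact_mod_cast hG)) hc.deriv
    refine ⟨C, fun s hs ↦ ?_⟩
    have := hC s hs
    rwa [bilateralLaplace_deriv (hG.of_le (by norm_cast; lia)) hc, norm_neg, norm_mul,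
      ← mul_assoc, ← pow_succ] at this

theorem exists_norm_bilateralLaplace_le (hG : ContDiff ℝ 2 G) (hc : HasCompactSupport G) (A : ℝ) :
    ∃ C, ∀ s : ℂ, |s.re| ≤ A → ‖bilateralLaplace G s‖ ≤ C * (1 + s.im ^ 2)⁻¹ := by
  obtain ⟨C₀, h₀⟩ := exists_norm_pow_mul_bilateralLaplace_le 0 (hG.of_le (by norm_num)) hc A
  obtain ⟨C₂, h₂⟩ := exists_norm_pow_mul_bilateralLaplace_le 2 hG hc A
  refine ⟨C₀ + C₂, fun s hs ↦ ?_⟩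
  rw [← div_eq_mul_inv, le_div_iff₀ (by positivity)]
  have h1 : s.im ^ 2 ≤ ‖s‖ ^ 2 := by
    rw [← sq_abs]; gcongr; exact abs_im_le_norm s
  have := h₀ s hs
  nlinarith [h₂ s hs, norm_nonneg (bilateralLaplace G s)]

theorem continuous_bilateralLaplace_line (hG : Continuous G) (hc : HasCompactSupport G) (σ : ℝ) :
    Continuous fun u : ℝ ↦ bilateralLaplace G (σ + u * I) :=
  (differentiable_bilateralLaplace hG hc).continuous.comp (by fun_prop)

theorem integrable_bilateralLaplace (hG : ContDiff ℝ 2 G) (hc : HasCompactSupport G) (σ : ℝ) :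
    Integrable fun u : ℝ ↦ bilateralLaplace G (σ + u * I) := by
  obtain ⟨C, hC⟩ := exists_norm_bilateralLaplace_le hG hc |σ|
  refine (integrable_inv_one_add_sq.const_mul C).mono'
    (continuous_bilateralLaplace_line hG.continuous hc σ).aestronglyMeasurable
    (Eventually.of_forall fun u ↦ ?_)
  simpa using hC (σ + u * I) (by simp)

theorem integrable_norm_sq_bilateralLaplace (hG : ContDiff ℝ 2 G) (hc : HasCompactSupport G)
    (σ : ℝ) : Integrable fun u : ℝ ↦ ‖bilateralLaplace G (σ + u * I)‖ ^ 2 := by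
  refine ((integrable_bilateralLaplace hG hc σ).norm.const_mul
    (∫ v : ℝ, Real.exp (|σ| * |v|) * ‖G v‖)).mono'
    ((continuous_bilateralLaplace_line hG.continuous hc σ).norm.pow 2).aestronglyMeasurable
    (Eventually.of_forall fun u ↦ ?_)
  rw [norm_pow, norm_norm, sq]
  gcongr
  exact norm_bilateralLaplace_le hG.continuous hc (by simp)

theorem contDiff_exp_mul {n : WithTop ℕ∞} (hG : ContDiff ℝ n G) (s : ℂ) :
    ContDiff ℝ n fun v : ℝ ↦ exp (s * v) * G v := by
  have : ContDiff ℝ n fun v : ℝ ↦ (v : ℂ) := ofRealCLM.contDiff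
  fun_prop

theorem integral_norm_sq_bilateralLaplace (hG : ContDiff ℝ (⊤ : ℕ∞) G) (hc : HasCompactSupport G)
    (σ : ℝ) : ∫ u : ℝ, ‖bilateralLaplace G (σ + u * I)‖ ^ 2 =
      2 * Real.pi * ∫ v : ℝ, ‖exp (σ * v) * G v‖ ^ 2 := by
  have hc' : HasCompactSupport fun v : ℝ ↦ exp (σ * v) * G v := hc.mul_left
  have h := (hc'.toSchwartzMap (contDiff_exp_mul hG σ)).integral_norm_sq_fourier
  rw [SchwartzMap.fourier_coe] at h
  simp only [HasCompactSupport.toSchwartzMap_toFun] at h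
  simp only [bilateralLaplace_eq_fourier]
  rw [Measure.integral_comp_mul_left
    (fun ξ ↦ ‖𝓕 (fun v : ℝ ↦ exp (σ * v) * G v) ξ‖ ^ 2) (-(2 * Real.pi)⁻¹)]
  have hpi := Real.pi_pos
  rw [inv_neg, inv_inv, abs_neg, abs_of_pos (by positivity), smul_eq_mul]
  congr 1

theorem integral_exp_mul_bilateralLaplace (hG : ContDiff ℝ 2 G)
    (hc : HasCompactSupport G) (σ v : ℝ) :
    ∫ u : ℝ, exp (-(σ + u * I) * v) * bilateralLaplace G (σ + u * I) = 2 * Real.pi * G v := by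
  set g : ℝ → ℂ := fun v ↦ exp (σ * v) * G v with hg
  have hgc : Continuous g := (contDiff_exp_mul hG σ).continuous
  have hpi := Real.pi_pos
  have hint : Integrable (𝓕 g) := by
    have := integrable_bilateralLaplace hG hc σ
    simp only [bilateralLaplace_eq_fourier] at this
    exact (integrable_comp_mul_left_iff _
      (neg_ne_zero.mpr (inv_ne_zero (by positivity)))).mp this
  have hinv : 𝓕⁻ (𝓕 g) v = g v :=
    congrFun (hgc.fourierInv_fourier_eq (integrable_exp_mul hG.continuous hc σ) hint) v
  rw [Real.fourierInv_eq'] at hinv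
  have hsub := Measure.integral_comp_mul_left (fun ξ : ℝ ↦
    exp (↑(2 * Real.pi * inner ℝ ξ v) * I) • 𝓕 g ξ) (-(2 * Real.pi)⁻¹)
  rw [hinv, inv_neg, inv_inv, abs_neg, abs_of_pos (by positivity)] at hsub
  have hpt (u : ℝ) : exp (-(σ + u * I) * v) * bilateralLaplace G (σ + u * I) =
      exp (-(σ * v)) * (exp (↑(2 * Real.pi * inner ℝ (-(2 * Real.pi)⁻¹ * u) v) * I) •
        𝓕 g (-(2 * Real.pi)⁻¹ * u)) := by
    rw [bilateralLaplace_eq_fourier, smul_eq_mul, ← mul_assoc, ← Complex.exp_add]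
    congr 2
    have : (Real.pi : ℂ) ≠ 0 := by exact_mod_cast Real.pi_ne_zero
    simp only [RCLike.inner_apply, conj_trivial]
    push_cast
    field_simp
    ring
  simp only [hpt]
  rw [integral_const_mul, hsub, hg, real_smul]
  have := Complex.exp_ne_zero (σ * v)
  rw [Complex.exp_neg]
  push_cast
  field_simp

/-- Shifting the line of integration inside a vertical strip. -/
theorem integral_line_eq_of_norm_le {H : ℂ → ℂ} {σ₁ σ₂ C : ℝ} (hσ : σ₁ ≤ σ₂)
    (hd : ∀ s : ℂ, σ₁ ≤ s.re → s.re ≤ σ₂ → DifferentiableAt ℂ H s)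
    (hb : ∀ s : ℂ, σ₁ ≤ s.re → s.re ≤ σ₂ → ‖H s‖ ≤ C * (1 + s.im ^ 2)⁻¹) :
    ∫ u : ℝ, H (σ₁ + u * I) = ∫ u : ℝ, H (σ₂ + u * I) := by
  have hint (σ : ℝ) (h1 : σ₁ ≤ σ) (h2 : σ ≤ σ₂) : Integrable fun u : ℝ ↦ H (σ + u * I) := by
    refine (integrable_inv_one_add_sq.const_mul C).mono' ?_ (Eventually.of_forall fun u ↦ ?_)
    · refine Continuous.aestronglyMeasurable (continuous_iff_continuousAt.mpr fun u ↦ ?_)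
      exact ContinuousAt.comp (f := fun u : ℝ ↦ (σ + u * I : ℂ))
        (hd _ (by simpa) (by simpa)).continuousAt (by fun_prop)
    · simpa using hb (σ + u * I) (by simpa) (by simpa)
  have hlim (σ : ℝ) (h1 : σ₁ ≤ σ) (h2 : σ ≤ σ₂) :
      Tendsto (fun U : ℝ ↦ ∫ u in (-U)..U, H (σ + u * I)) atTop (𝓝 (∫ u : ℝ, H (σ + u * I))) :=
    intervalIntegral_tendsto_integral (hint σ h1 h2) tendsto_neg_atTop_atBot tendsto_id
  have hrect (U : ℝ) (hU : 0 ≤ U) :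
      ‖(∫ u in (-U)..U, H (σ₂ + u * I)) - ∫ u in (-U)..U, H (σ₁ + u * I)‖
        ≤ 2 * (C * (1 + U ^ 2)⁻¹ * (σ₂ - σ₁)) := by
    have h := integral_boundary_rect_eq_zero_of_differentiableOn H (σ₁ + (-U : ℝ) * I) (σ₂ + U * I)
      (fun s hs ↦ by
        simp only [add_re, ofReal_re, mul_re, I_re, mul_zero, ofReal_im, I_im, mul_one, sub_self,
          add_zero, add_im, mul_im, zero_add, mem_reProdIm, Set.uIcc_of_le hσ] at hs
        exact (hd s hs.1.1 hs.1.2).differentiableWithinAt)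
    simp only [add_re, ofReal_re, mul_re, I_re, mul_zero, ofReal_im, I_im, mul_one, sub_self,
      add_zero, add_im, mul_im, zero_add] at h
    have hb' (y : ℝ) (hy : y ^ 2 = U ^ 2) :
        ‖∫ x in σ₁..σ₂, H (x + y * I)‖ ≤ C * (1 + U ^ 2)⁻¹ * (σ₂ - σ₁) := by
      rw [← abs_of_nonneg (sub_nonneg.mpr hσ)]
      refine intervalIntegral.norm_integral_le_of_norm_le_const fun x hx ↦ ?_
      rw [Set.uIoc_of_le hσ] at hx
      simpa [hy] using hb (x + y * I) (by simpa using hx.1.le) (by simpa using hx.2)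
    have h1 := hb' (-U) (by ring)
    have h2 := hb' U rfl
    have h3 : I * ((∫ u in (-U)..U, H (σ₂ + u * I)) - ∫ u in (-U)..U, H (σ₁ + u * I)) =
        (∫ x in σ₁..σ₂, H (x + U * I)) - ∫ x in σ₁..σ₂, H (x + (-U : ℝ) * I) := by
      simp only [smul_eq_mul] at h
      linear_combination h
    have h4 (z : ℂ) : ‖z‖ = ‖I * z‖ := by simp
    rw [h4, h3]
    exact (norm_sub_le _ _).trans (by linarith)
  have h0 : Tendsto (fun U : ℝ ↦ 2 * (C * (1 + U ^ 2)⁻¹ * (σ₂ - σ₁))) atTop (𝓝 0) := by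
    have h1 : Tendsto (fun U : ℝ ↦ (1 + U ^ 2)⁻¹) atTop (𝓝 0) :=
      tendsto_inv_atTop_zero.comp
        (tendsto_atTop_add_const_left _ _ (tendsto_pow_atTop two_ne_zero))
    simpa using ((h1.const_mul C).mul_const (σ₂ - σ₁)).const_mul 2
  have h1 := squeeze_zero_norm' ((eventually_ge_atTop 0).mono hrect) h0
  have h2 := (hlim σ₂ hσ le_rfl).sub (hlim σ₁ le_rfl hσ)
  exact (sub_eq_zero.mp (tendsto_nhds_unique h2 h1)).symm

end BilateralLaplace

/-! ### Smoothed sums over primes twisted by a character -/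

section SmoothSum

open MeasureTheory Complex Filter Topology DirichletCharacter

variable {G : ℝ → ℂ} {N : ℕ} [NeZero N] {χ : DirichletCharacter ℂ N}

/-- Mellin inversion for a smoothed sum over primes twisted by a Dirichlet character. -/
theorem two_pi_mul_tsum_twist_vonMangoldt (χ : DirichletCharacter ℂ N) (hG : ContDiff ℝ 2 G)
    (hc : HasCompactSupport G) :
    2 * Real.pi * ∑' n : ℕ, χ n * ArithmeticFunction.vonMangoldt n * G (Real.log n) =
      ∫ u : ℝ, -deriv χ.LFunction ((2 : ℝ) + u * I) / χ.LFunction ((2 : ℝ) + u * I) *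
        bilateralLaplace G ((2 : ℝ) + u * I) := by
  set f : ℕ → ℂ := fun n ↦ χ n * ArithmeticFunction.vonMangoldt n with hf
  set F : ℕ → ℝ → ℂ := fun n u ↦ f n *
    (exp (-((2 : ℝ) + u * I) * Real.log n) * bilateralLaplace G ((2 : ℝ) + u * I)) with hF
  have hBi := integrable_bilateralLaplace hG hc 2
  have hterm (s : ℂ) (n : ℕ) : LSeries.term f s n = f n * exp (-s * Real.log n) := by
    rcases eq_or_ne n 0 with rfl | hn
    · simp [hf]
    · rw [LSeries.term_of_ne_zero hn, cpow_def_of_ne_zero (by exact_mod_cast hn), ofReal_log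
        (by positivity), div_eq_mul_inv, ← Complex.exp_neg]
      push_cast
      congr 2
      ring
  have hFterm (n : ℕ) (u : ℝ) : F n u = LSeries.term f ((2 : ℝ) + u * I) n *
      bilateralLaplace G ((2 : ℝ) + u * I) := by
    rw [hterm, hF]; ring
  have hnorm (n : ℕ) (u : ℝ) : ‖F n u‖ = ‖LSeries.term f (2 : ℝ) n‖ *
      ‖bilateralLaplace G ((2 : ℝ) + u * I)‖ := by
    rw [hFterm, norm_mul, hterm, hterm, norm_mul (f n), norm_mul (f n), Complex.norm_exp,
      Complex.norm_exp,
      re_mul_ofReal, re_mul_ofReal]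
    simp
  have hsum (u : ℝ) : LSeriesSummable f ((2 : ℝ) + u * I) :=
    LSeriesSummable_twist_vonMangoldt χ (by simp)
  have hFi (n : ℕ) : Integrable (F n) := by
    refine (hBi.norm.const_mul ‖LSeries.term f (2 : ℝ) n‖).mono' ?_
      (Eventually.of_forall fun u ↦ (hnorm n u).le)
    have := continuous_bilateralLaplace_line hG.continuous hc 2
    exact Continuous.aestronglyMeasurable (by fun_prop)
  have hFs : Summable fun n ↦ ∫ u, ‖F n u‖ := by
    simp only [hnorm, integral_const_mul]
    have := hsum 0
    simp only [ofReal_zero, zero_mul, add_zero] at this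
    exact this.norm.mul_right _
  have h := (hasSum_integral_of_summable_integral_norm hFi hFs).tsum_eq
  have hI (n : ℕ) : ∫ u, F n u = 2 * Real.pi * (f n * G (Real.log n)) := by
    rw [hF, integral_const_mul, integral_exp_mul_bilateralLaplace hG hc]
    ring
  simp only [hI, tsum_mul_left] at h
  rw [h]
  congr 1
  ext u
  simp only [hFterm, tsum_mul_right]
  congr 1
  have h1 : (1 : ℝ) < ((2 : ℝ) + u * I : ℂ).re := by simp
  rw [LFunction_eq_LSeries χ h1, deriv_LFunction_eq_deriv_LSeries χ h1]
  exact LSeries_twist_vonMangoldt_eq χ h1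

theorem GRH.LFunction_ne_zero (hGRH : GRH) (hχ : χ ≠ 1) {s : ℂ} (hs : 1 / 2 < s.re) :
    χ.LFunction s ≠ 0 := by
  rcases lt_or_ge s.re 1 with h1 | h1
  · exact fun h0 ↦ hs.ne' (hGRH N χ s h0 (by linarith) h1)
  · exact LFunction_ne_zero_of_one_le_re χ (.inl hχ) h1

/-- The explicit formula on GRH: the contour is moved to the line `re s = 1 / 2 + ε`. -/
theorem GRH.norm_tsum_twist_vonMangoldt_le (hGRH : GRH) (hχ : χ ≠ 1) (hG : ContDiff ℝ 3 G)
    (hc : HasCompactSupport G) {ε : ℝ} (hε : 0 < ε) (hε1 : ε ≤ 1) :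
    2 * Real.pi * ‖∑' n : ℕ, χ n * ArithmeticFunction.vonMangoldt n * G (Real.log n)‖ ≤
      ∫ u : ℝ, 12 / ε ^ 2 * Real.log (8 * N * (|u| + 4)) *
        ‖bilateralLaplace G ((1 / 2 + ε : ℝ) + u * I)‖ := by
  have hG2 : ContDiff ℝ 2 G := hG.of_le (by norm_num)
  obtain ⟨C, hC⟩ := exists_norm_pow_mul_bilateralLaplace_le 3 hG hc 2
  have hN : (1 : ℝ) ≤ N := by exact_mod_cast NeZero.one_le
  have hlog0 (s : ℂ) : 0 ≤ Real.log (8 * N * (|s.im| + 4)) :=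
    Real.log_nonneg (by nlinarith [abs_nonneg s.im])
  have hbound (s : ℂ) (h1 : 1 / 2 ≤ s.re) (h2 : s.re ≤ 2) :
      12 / ε ^ 2 * Real.log (8 * N * (|s.im| + 4)) * ‖bilateralLaplace G s‖ ≤
        (12 / ε ^ 2 * (8 * N * 9 * 5) * C) * (1 + s.im ^ 2)⁻¹ := by
    have hre : s.re ≤ ‖s‖ := re_le_norm s
    have him : |s.im| ≤ ‖s‖ := abs_im_le_norm s
    have hlog : Real.log (8 * N * (|s.im| + 4)) ≤ 8 * N * 9 * ‖s‖ := by
      refine (Real.log_le_self (by positivity)).trans ?_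
      have : |s.im| + 4 ≤ 9 * ‖s‖ := by linarith
      calc (8 * N * (|s.im| + 4) : ℝ) ≤ 8 * N * (9 * ‖s‖) := by gcongr
        _ = _ := by ring
    have hsq : 1 + s.im ^ 2 ≤ 5 * ‖s‖ ^ 2 := by
      have : s.im ^ 2 ≤ ‖s‖ ^ 2 := by rw [← sq_abs]; gcongr
      nlinarith
    rw [← div_eq_mul_inv, le_div_iff₀ (by positivity)]
    calc 12 / ε ^ 2 * Real.log (8 * N * (|s.im| + 4)) * ‖bilateralLaplace G s‖ * (1 + s.im ^ 2)
        ≤ 12 / ε ^ 2 * (8 * N * 9 * ‖s‖) * ‖bilateralLaplace G s‖ * (5 * ‖s‖ ^ 2) := by gcongr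
      _ = 12 / ε ^ 2 * (8 * N * 9 * 5) * (‖s‖ ^ 3 * ‖bilateralLaplace G s‖) := by ring
      _ ≤ _ := by
        gcongr
        exact hC s (abs_le.mpr ⟨by linarith, h2⟩)
  have hd := differentiable_LFunction hχ
  have hptw (s : ℂ) (h1 : 1 / 2 + ε ≤ s.re) (h2 : s.re ≤ 2) :
      ‖-deriv χ.LFunction s / χ.LFunction s * bilateralLaplace G s‖ ≤
        12 / ε ^ 2 * Real.log (8 * N * (|s.im| + 4)) * ‖bilateralLaplace G s‖ := by
    rw [norm_mul, neg_div, norm_neg]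
    gcongr
    exact hGRH.norm_deriv_LFunction_div_le hχ hε hε1 h1 h2
  have hshift := integral_line_eq_of_norm_le
    (H := fun s ↦ -deriv χ.LFunction s / χ.LFunction s * bilateralLaplace G s)
    (σ₁ := 1 / 2 + ε) (σ₂ := 2) (C := 12 / ε ^ 2 * (8 * N * 9 * 5) * C) (by linarith)
    (fun s h1 h2 ↦ ?_) (fun s h1 h2 ↦ (hptw s h1 h2).trans (hbound s (by linarith) h2))
  · calc 2 * Real.pi * ‖∑' n : ℕ, χ n * ArithmeticFunction.vonMangoldt n * G (Real.log n)‖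
        = ‖2 * Real.pi * ∑' n : ℕ, χ n * ArithmeticFunction.vonMangoldt n * G (Real.log n)‖ := by
          rw [norm_mul, norm_mul, Complex.norm_two, Complex.norm_real, Real.norm_eq_abs,
            abs_of_pos Real.pi_pos]
      _ ≤ _ := by
        rw [two_pi_mul_tsum_twist_vonMangoldt χ hG2 hc, ← hshift]
        refine norm_integral_le_of_norm_le ?_ (Eventually.of_forall fun u ↦ ?_)
        · refine (integrable_inv_one_add_sq.const_mul (12 / ε ^ 2 * (8 * N * 9 * 5) * C)).mono' ?_
            (Eventually.of_forall fun u ↦ ?_)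
          · have := continuous_bilateralLaplace_line hG.continuous hc (1 / 2 + ε)
            refine Continuous.aestronglyMeasurable (.mul (.mul (by fun_prop) (.log (by fun_prop)
              fun u ↦ ?_)) this.norm)
            positivity
          · have := hbound ((1 / 2 + ε : ℝ) + u * I) (by simp; linarith) (by simp; linarith)
            have h0 := hlog0 ((1 / 2 + ε : ℝ) + u * I)
            simp only [add_im, ofReal_im, mul_im, ofReal_re, I_im, mul_one, I_re, mul_zero,
              add_zero, zero_add] at this h0
            rwa [Real.norm_of_nonneg (by positivity)]
        · simpa using hptw ((1 / 2 + ε : ℝ) + u * I) (by simp) (by simp; linarith)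
  · have hne := hGRH.LFunction_ne_zero hχ (s := s) (by linarith)
    have hdd : DifferentiableAt ℂ (deriv χ.LFunction) s :=
      (hd.contDiff (n := 2)).differentiable_deriv_two s
    exact ((hdd.neg).div (hd s) hne).mul (differentiable_bilateralLaplace hG.continuous hc s)

end SmoothSum

section SmoothSumBound

open MeasureTheory Complex Filter Topology

variable {G : ℝ → ℂ} {a b W Y σ : ℝ}

theorem integral_norm_sq_exp_mul_le (hab : a ≤ b) (hσ : 0 ≤ σ)
    (hsupp : ∀ v ∉ Set.Icc a b, G v = 0) (hW : ∀ v, ‖G v‖ ≤ W) :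
    ∫ v : ℝ, ‖exp (σ * v) * G v‖ ^ 2 ≤ (W * Real.exp (σ * b)) ^ 2 * (b - a) := by
  rw [← setIntegral_eq_integral_of_forall_compl_eq_zero (s := Set.Icc a b)
    fun v hv ↦ by simp [hsupp v hv]]
  refine (Real.le_norm_self _).trans ?_
  have h := norm_setIntegral_le_of_norm_le_const (μ := volume) (s := Set.Icc a b)
    (f := fun v : ℝ ↦ ‖exp (σ * v) * G v‖ ^ 2) (C := (W * Real.exp (σ * b)) ^ 2) (by simp)
    fun v hv ↦ ?_
  · simpa [Real.volume_real_Icc_of_le hab] using h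
  · rw [norm_pow, norm_norm, norm_mul, Complex.norm_exp, mul_comm]
    have hre : ((σ : ℂ) * v).re = σ * v := by simp
    rw [hre]
    gcongr
    · exact (norm_nonneg _).trans (hW v)
    · exact hW v
    · exact hv.2

theorem deriv_eq_zero_of_notMem_Icc (hsupp : ∀ v ∉ Set.Icc a b, G v = 0) (v : ℝ)
    (hv : v ∉ Set.Icc a b) : deriv G v = 0 := by
  have h : G =ᶠ[𝓝 v] fun _ ↦ 0 := by
    filter_upwards [isClosed_Icc.isOpen_compl.mem_nhds hv] with w hw using hsupp w hw
  simpa using h.deriv_eq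

/-- A weighted form of Plancherel's identity for a smooth function whose derivative is at most `Y`
times as large as the function itself. -/
theorem exists_integrable_norm_sq_bilateralLaplace_mul_le (hG : ContDiff ℝ (⊤ : ℕ∞) G)
    (hab : a ≤ b) (hσ : 0 ≤ σ) (hY : 0 < Y) (hsupp : ∀ v ∉ Set.Icc a b, G v = 0)
    (hW : ∀ v, ‖G v‖ ≤ W) (hWY : ∀ v, ‖deriv G v‖ ≤ W * Y) :
    ∃ Q : ℝ → ℝ, Integrable Q ∧
      ∫ u, Q u ≤ 4 * Real.pi * ((W * Real.exp (σ * b)) ^ 2 * (b - a)) ∧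
      ∀ u : ℝ, ‖bilateralLaplace G (σ + u * I)‖ ^ 2 * (1 + (u / Y) ^ 2) ≤ Q u := by
  have hc : HasCompactSupport G := HasCompactSupport.intro isCompact_Icc hsupp
  have hG' : ContDiff ℝ (⊤ : ℕ∞) (deriv G) := hG.deriv'
  have hQ₁ := integrable_norm_sq_bilateralLaplace (mod_cast contDiff_infty.mp hG 2) hc σ
  have hQ₂ := integrable_norm_sq_bilateralLaplace (mod_cast contDiff_infty.mp hG' 2) hc.deriv σ
  refine ⟨fun u ↦ ‖bilateralLaplace G (σ + u * I)‖ ^ 2 +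
    (Y ^ 2)⁻¹ * ‖bilateralLaplace (deriv G) (σ + u * I)‖ ^ 2, hQ₁.add (hQ₂.const_mul _), ?_,
    fun u ↦ ?_⟩
  · rw [integral_add hQ₁ (hQ₂.const_mul _), integral_const_mul,
      integral_norm_sq_bilateralLaplace hG hc, integral_norm_sq_bilateralLaplace hG' hc.deriv]
    have h1 := integral_norm_sq_exp_mul_le hab hσ hsupp hW
    have h2 := integral_norm_sq_exp_mul_le hab hσ (deriv_eq_zero_of_notMem_Icc hsupp) hWY
    have hpi := Real.pi_pos
    calc _ ≤ 2 * Real.pi * ((W * Real.exp (σ * b)) ^ 2 * (b - a)) + (Y ^ 2)⁻¹ *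
          (2 * Real.pi * ((W * Y * Real.exp (σ * b)) ^ 2 * (b - a))) := by gcongr
      _ = _ := by field_simp; ring
  · have h1 : u ^ 2 ≤ ‖(σ + u * I : ℂ)‖ ^ 2 := by
      rw [← sq_abs]
      gcongr
      simpa using abs_im_le_norm (σ + u * I : ℂ)
    dsimp only
    rw [bilateralLaplace_deriv (hG.of_le (by exact_mod_cast le_top)) hc, norm_neg, norm_mul,
      mul_pow]
    calc _ = ‖bilateralLaplace G (σ + u * I)‖ ^ 2 +
          (Y ^ 2)⁻¹ * (u ^ 2 * ‖bilateralLaplace G (σ + u * I)‖ ^ 2) := by field_simp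
      _ ≤ _ := by gcongr

theorem log_conductor_le {N : ℕ} [NeZero N] (hY : 1 ≤ Y) (u : ℝ) :
    Real.log (8 * N * (|u| + 4)) ≤
      5 * Real.log (40 * N * Y) * (1 + (u / Y) ^ 2) ^ (1 / 8 : ℝ) := by
  have hN : (1 : ℝ) ≤ N := by exact_mod_cast NeZero.one_le
  set x := u / Y with hx
  have hu : |u| = |x| * Y := by rw [hx, abs_div, abs_of_pos (by positivity : 0 < Y)]; field_simp
  have h1 : |u| + 4 ≤ 5 * Y * √(1 + x ^ 2) := by
    have : |x| + 4 ≤ 5 * √(1 + x ^ 2) := by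
      refine abs_le_of_sq_le_sq' ?_ (by positivity) |>.2
      rw [mul_pow, Real.sq_sqrt (by positivity), ← sq_abs x]
      nlinarith [sq_nonneg (|x| - 1), sq_nonneg |x|]
    rw [hu]; nlinarith
  have hlog1 : 1 ≤ Real.log (40 * N * Y) := by
    rw [Real.le_log_iff_exp_le (by positivity)]
    have := Real.exp_one_lt_three
    nlinarith
  have hr : 1 ≤ (1 + x ^ 2) ^ (1 / 8 : ℝ) :=
    Real.one_le_rpow (by nlinarith [sq_nonneg x]) (by norm_num)
  have hlx := Real.log_le_rpow_div (x := 1 + x ^ 2) (by positivity) (ε := 1 / 8) (by norm_num)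
  calc Real.log (8 * N * (|u| + 4)) ≤ Real.log (40 * N * Y * √(1 + x ^ 2)) := by
        refine Real.log_le_log (by positivity) ?_
        calc (8 * N * (|u| + 4) : ℝ) ≤ 8 * N * (5 * Y * √(1 + x ^ 2)) := by gcongr
          _ = _ := by ring
    _ = Real.log (40 * N * Y) + Real.log (1 + x ^ 2) / 2 := by
        rw [Real.log_mul (by positivity) (by positivity), Real.log_sqrt (by positivity)]
    _ ≤ _ := by nlinarith

/-- Under GRH, a sum over primes twisted by `χ ≠ 1` and by a smooth weight oscillating with frequency
`Y` exhibits square-root cancellation, up to a factor `√Y`. -/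
theorem GRH.exists_norm_tsum_twist_vonMangoldt_le (hGRH : GRH) {ε : ℝ} (hε : 0 < ε) (hε1 : ε ≤ 1) :
    ∃ M > 0, ∀ (N : ℕ) [NeZero N] (χ : DirichletCharacter ℂ N) (G : ℝ → ℂ) (a b W Y : ℝ),
      χ ≠ 1 → ContDiff ℝ (⊤ : ℕ∞) G → a ≤ b → 0 < W → 1 ≤ Y →
      (∀ v ∉ Set.Icc a b, G v = 0) → (∀ v, ‖G v‖ ≤ W) → (∀ v, ‖deriv G v‖ ≤ W * Y) →
      ‖∑' n : ℕ, χ n * ArithmeticFunction.vonMangoldt n * G (Real.log n)‖ ≤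
        M * (b - a + 1) * (W * Real.exp ((1 / 2 + ε) * b) * √Y * Real.log (40 * N * Y)) := by
  set K : ℝ := 12 / ε ^ 2 with hK
  set J : ℝ := ∫ x : ℝ, (1 + x ^ 2) ^ (-(3 / 4) : ℝ) with hJ
  have hJ0 : 0 ≤ J := integral_nonneg fun x ↦ by positivity
  have hpi := Real.pi_pos
  refine ⟨1 + 25 / (4 * Real.pi) * K ^ 2 * J, by positivity, ?_⟩
  intro N _ χ G a b W Y hχ hG hab hW0 hY hsupp hW hWY
  have hc : HasCompactSupport G := HasCompactSupport.intro isCompact_Icc hsupp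
  have hN : (1 : ℝ) ≤ N := by exact_mod_cast NeZero.one_le
  obtain ⟨Q, hQi, hQ, hQu⟩ := exists_integrable_norm_sq_bilateralLaplace_mul_le hG hab
    (by positivity : 0 ≤ 1 / 2 + ε) (by positivity) hsupp hW hWY
  set E := Real.exp ((1 / 2 + ε) * b) with hE
  have hE0 : 0 < E := Real.exp_pos _
  set L := Real.log (40 * N * Y) with hL
  have hL0 : 0 < L := Real.log_pos (by nlinarith)
  have hY0 : 0 < Y := by linarith
  set l : ℝ := L * √Y / (W * E) with hl
  have hl0 : 0 < l := by positivity
  have hJi : Integrable fun x : ℝ ↦ (1 + x ^ 2) ^ (-(3 / 4) : ℝ) := by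
    have := integrable_rpow_neg_one_add_norm_sq (E := ℝ) (μ := volume) (r := 3 / 2)
      (by norm_num)
    norm_num at this ⊢
    simpa using this
  have hJi' : Integrable fun u : ℝ ↦ (1 + (u / Y) ^ 2) ^ (-(3 / 4) : ℝ) := hJi.comp_div hY0.ne'
  have hJY : ∫ u : ℝ, (1 + (u / Y) ^ 2) ^ (-(3 / 4) : ℝ) = Y * J := by
    rw [Measure.integral_comp_div (fun x : ℝ ↦ (1 + x ^ 2) ^ (-(3 / 4) : ℝ)), abs_of_pos hY0,
      smul_eq_mul]
  have hptw (u : ℝ) : K * Real.log (8 * N * (|u| + 4)) *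
      ‖bilateralLaplace G ((1 / 2 + ε : ℝ) + u * I)‖ ≤
        l / 2 * Q u + 25 * K ^ 2 * L ^ 2 / (2 * l) * (1 + (u / Y) ^ 2) ^ (-(3 / 4) : ℝ) := by
    set w : ℝ := 1 + (u / Y) ^ 2 with hw
    have hw0 : 0 < w := by positivity
    set β := ‖bilateralLaplace G ((1 / 2 + ε : ℝ) + u * I)‖
    have h34 : w ^ (-(3 / 4) : ℝ) = (w ^ (1 / 8 : ℝ)) ^ 2 / w := by
      rw [← Real.rpow_natCast, ← Real.rpow_mul hw0.le, ← Real.rpow_sub_one hw0.ne']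
      norm_num
    rw [h34]
    set r := w ^ (1 / 8 : ℝ)
    calc K * Real.log (8 * N * (|u| + 4)) * β ≤ K * (5 * L * r) * β := by
          gcongr; exact log_conductor_le hY u
      _ ≤ l / 2 * (β ^ 2 * w) + 25 * K ^ 2 * L ^ 2 / (2 * l) * (r ^ 2 / w) := by
          rw [← sub_nonneg]
          have : l / 2 * (β ^ 2 * w) + 25 * K ^ 2 * L ^ 2 / (2 * l) * (r ^ 2 / w) -
              K * (5 * L * r) * β = (l * β * w - 5 * K * L * r) ^ 2 / (2 * l * w) := by
            field_simp; ring
          rw [this]; positivity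
      _ ≤ _ := by gcongr; exact hQu u
  have hmain := hGRH.norm_tsum_twist_vonMangoldt_le hχ (mod_cast contDiff_infty.mp hG 3) hc
    hε hε1
  have hint : ∫ u : ℝ, K * Real.log (8 * N * (|u| + 4)) *
      ‖bilateralLaplace G ((1 / 2 + ε : ℝ) + u * I)‖ ≤
        l / 2 * (4 * Real.pi * ((W * E) ^ 2 * (b - a))) +
          25 * K ^ 2 * L ^ 2 / (2 * l) * (Y * J) := by
    refine (integral_mono_of_nonneg (Eventually.of_forall fun u ↦ ?_)
      ((hQi.const_mul (l / 2)).add (hJi'.const_mul (25 * K ^ 2 * L ^ 2 / (2 * l))))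
      (Eventually.of_forall hptw)).trans ?_
    · have : 0 ≤ Real.log (8 * N * (|u| + 4)) :=
        Real.log_nonneg (by nlinarith [abs_nonneg u])
      positivity
    · rw [integral_add' (hQi.const_mul (l / 2)) (hJi'.const_mul _), integral_const_mul,
        integral_const_mul, hJY]
      gcongr
  have hfin : l / 2 * (4 * Real.pi * ((W * E) ^ 2 * (b - a))) +
      25 * K ^ 2 * L ^ 2 / (2 * l) * (Y * J) =
        2 * Real.pi * ((b - a + 25 / (4 * Real.pi) * K ^ 2 * J) * (W * E * √Y * L)) := by
    have hYs : Y = √Y ^ 2 := (Real.sq_sqrt hY0.le).symm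
    have hs0 : 0 < √Y := Real.sqrt_pos.mpr hY0
    rw [hl]
    conv_lhs => rw [hYs, Real.sqrt_sq hs0.le]
    field_simp
    ring
  have h2 := le_of_mul_le_mul_left ((hmain.trans hint).trans_eq hfin) (by positivity)
  refine h2.trans ?_
  gcongr
  have : 0 ≤ 25 / (4 * Real.pi) * K ^ 2 * J := by positivity
  nlinarith [sub_nonneg.mpr hab]

end SmoothSumBound

/-! ### The smooth weight -/

section Weight

open Filter Topology

theorem exists_norm_deriv_smoothTransition_le :
    ∃ A, 0 ≤ A ∧ ∀ x, |deriv Real.smoothTransition x| ≤ A := by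
  have hd : Continuous (deriv Real.smoothTransition) :=
    Real.smoothTransition.contDiff (n := 1).continuous_deriv le_rfl
  obtain ⟨A, hA⟩ := isCompact_Icc.exists_bound_of_continuousOn (s := Set.Icc (0 : ℝ) 1) hd.continuousOn
  refine ⟨A, (norm_nonneg _).trans (hA 0 (by simp)), fun x ↦ ?_⟩
  by_cases hx : x ∈ Set.Icc (0 : ℝ) 1
  · exact hA x hx
  · have h0 : deriv Real.smoothTransition x = 0 := by
      rw [Set.mem_Icc, not_and_or, not_le, not_le] at hx
      rcases hx with hx | hx
      · have h : Real.smoothTransition =ᶠ[𝓝 x] fun _ ↦ 0 := by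
          filter_upwards [Iio_mem_nhds hx] with w hw using
            Real.smoothTransition.zero_of_nonpos (le_of_lt hw)
        simpa using h.deriv_eq
      · have h : Real.smoothTransition =ᶠ[𝓝 x] fun _ ↦ 1 := by
          filter_upwards [Ioi_mem_nhds hx] with w hw using
            Real.smoothTransition.one_of_one_le (le_of_lt hw)
        simpa using h.deriv_eq
    rw [h0, abs_zero]
    exact (norm_nonneg _).trans (hA 0 (by simp))

/-- A smooth cutoff to `[a, b]` whose transition regions have length `Y⁻¹`. -/
noncomputable def smoothCutoff (a b Y v : ℝ) : ℝ :=
  Real.smoothTransition ((v - a) * Y) * Real.smoothTransition ((b - v) * Y)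

variable {a b Y v : ℝ}

theorem contDiff_smoothCutoff (a b Y : ℝ) : ContDiff ℝ (⊤ : ℕ∞) (smoothCutoff a b Y) := by
  have := Real.smoothTransition.contDiff (n := (⊤ : ℕ∞))
  exact (this.comp (by fun_prop)).mul (this.comp (by fun_prop))

theorem smoothCutoff_nonneg (a b Y v : ℝ) : 0 ≤ smoothCutoff a b Y v :=
  mul_nonneg (Real.smoothTransition.nonneg _) (Real.smoothTransition.nonneg _)

theorem smoothCutoff_le_one (a b Y v : ℝ) : smoothCutoff a b Y v ≤ 1 :=
  mul_le_one₀ (Real.smoothTransition.le_one _) (Real.smoothTransition.nonneg _)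
    (Real.smoothTransition.le_one _)

theorem smoothCutoff_eq_zero_of_le_left (hY : 0 ≤ Y) (hv : v ≤ a) : smoothCutoff a b Y v = 0 := by
  rw [smoothCutoff, Real.smoothTransition.zero_of_nonpos
    (mul_nonpos_of_nonpos_of_nonneg (by linarith) hY), zero_mul]

theorem smoothCutoff_eq_zero_of_right_le (hY : 0 ≤ Y) (hv : b ≤ v) : smoothCutoff a b Y v = 0 := by
  rw [smoothCutoff, Real.smoothTransition.zero_of_nonpos (x := (b - v) * Y)
    (mul_nonpos_of_nonpos_of_nonneg (by linarith) hY), mul_zero]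

theorem smoothCutoff_eq_one (hY : 0 < Y) (h1 : a + Y⁻¹ ≤ v) (h2 : v ≤ b - Y⁻¹) :
    smoothCutoff a b Y v = 1 := by
  have h (x : ℝ) (hx : Y⁻¹ ≤ x) : Real.smoothTransition (x * Y) = 1 := by
    refine Real.smoothTransition.one_of_one_le ?_
    calc (1 : ℝ) = Y⁻¹ * Y := by field_simp
      _ ≤ x * Y := by gcongr
  rw [smoothCutoff, h _ (by linarith), h _ (by linarith), mul_one]

theorem abs_deriv_smoothCutoff_le {A : ℝ} (hA : ∀ x, |deriv Real.smoothTransition x| ≤ A)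
    (a b : ℝ) (hY : 0 ≤ Y) (v : ℝ) : |deriv (smoothCutoff a b Y) v| ≤ 2 * A * Y := by
  have hst (x : ℝ) : HasDerivAt Real.smoothTransition (deriv Real.smoothTransition x) x :=
    (Real.smoothTransition.contDiff (n := 1).differentiable one_ne_zero x).hasDerivAt
  have h1 : HasDerivAt (fun v ↦ (v - a) * Y) Y v := by
    simpa using ((hasDerivAt_id v).sub_const a).mul_const Y
  have h2 : HasDerivAt (fun v ↦ (b - v) * Y) (-Y) v := by
    simpa using ((hasDerivAt_id v).const_sub b).mul_const Y
  have h := ((hst _).comp v h1).mul ((hst _).comp v h2)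
  have habs (x : ℝ) : |Real.smoothTransition x| ≤ 1 :=
    abs_le.mpr ⟨by linarith [Real.smoothTransition.nonneg x], Real.smoothTransition.le_one x⟩
  have hA0 : 0 ≤ A := (abs_nonneg _).trans (hA 0)
  rw [show deriv (smoothCutoff a b Y) v = _ from h.deriv]
  refine (abs_add_le _ _).trans ?_
  simp only [Function.comp_apply, abs_mul, abs_neg, abs_of_nonneg hY]
  calc _ ≤ A * Y * 1 + 1 * (A * Y) := by
        gcongr
        exacts [hA _, habs _, habs _, hA _]
    _ = _ := by ring

/-- The increment `(y + 1) ^ γ - y ^ γ` at `y = exp v`. -/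
noncomputable def rpowIncrement (γ v : ℝ) : ℝ := (Real.exp v + 1) ^ γ - Real.exp (γ * v)

variable {γ c t : ℝ}

theorem contDiff_rpowIncrement (γ : ℝ) {n : WithTop ℕ∞} : ContDiff ℝ n (rpowIncrement γ) := by
  refine ContDiff.sub (ContDiff.rpow_const_of_ne (by fun_prop) fun v ↦ ?_) (by fun_prop)
  positivity

theorem rpowIncrement_nonneg (hγ : 0 ≤ γ) (v : ℝ) : 0 ≤ rpowIncrement γ v := by
  rw [rpowIncrement, sub_nonneg, mul_comm, Real.exp_mul]
  gcongr
  linarith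

theorem rpowIncrement_le (hγ0 : 0 ≤ γ) (hγ1 : γ ≤ 1) (v : ℝ) :
    rpowIncrement γ v ≤ Real.exp ((γ - 1) * v) := by
  have h1 : Real.exp v + 1 = Real.exp v * (1 + Real.exp (-v)) := by
    rw [mul_add, ← Real.exp_add]; simp
  have h2 := rpow_one_add_le_one_add_mul_self (s := Real.exp (-v))
    (by linarith [Real.exp_pos (-v)]) hγ0 hγ1
  have h3 : Real.exp ((γ - 1) * v) = Real.exp (γ * v) * Real.exp (-v) := by
    rw [← Real.exp_add]; ring_nf
  rw [rpowIncrement, h1, Real.mul_rpow (by positivity) (by positivity), ← Real.exp_mul, mul_comm v,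
    h3]
  have := Real.exp_pos (-v)
  have := Real.exp_pos (γ * v)
  calc _ ≤ Real.exp (γ * v) * (1 + γ * Real.exp (-v)) - Real.exp (γ * v) := by gcongr
    _ = γ * (Real.exp (γ * v) * Real.exp (-v)) := by ring
    _ ≤ _ := mul_le_of_le_one_left (by positivity) hγ1

theorem abs_deriv_rpowIncrement_le (hγ0 : 0 ≤ γ) (hγ1 : γ ≤ 1) (v : ℝ) :
    |deriv (rpowIncrement γ) v| ≤ Real.exp ((γ - 1) * v) := by
  have hy := Real.exp_pos v
  set y := Real.exp v with hyd
  have h1 : HasDerivAt (fun v ↦ (Real.exp v + 1) ^ γ) (y * γ * (y + 1) ^ (γ - 1)) v :=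
    ((Real.hasDerivAt_exp v).add_const 1).rpow_const (.inl (by positivity))
  have h2 : HasDerivAt (fun v ↦ Real.exp (γ * v)) (Real.exp (γ * v) * γ) v := by
    simpa using ((hasDerivAt_id v).const_mul γ).exp
  have e1 : Real.exp (γ * v) = y ^ γ := by rw [mul_comm, Real.exp_mul]
  have e2 : Real.exp ((γ - 1) * v) = y ^ γ / y := by
    rw [mul_comm, Real.exp_mul, ← hyd, Real.rpow_sub_one hy.ne']
  rw [show deriv (rpowIncrement γ) v = _ from (h1.sub h2).deriv, e1, e2,
    Real.rpow_sub_one (by positivity)]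
  have hyγ : 0 < y ^ γ := by positivity
  have hle : y ^ γ ≤ (y + 1) ^ γ := by gcongr; linarith
  have hle2 : (y + 1) ^ γ ≤ y ^ γ * ((y + 1) / y) := by
    have := rpowIncrement_le hγ0 hγ1 v
    rw [rpowIncrement, e1, e2, ← hyd] at this
    calc (y + 1) ^ γ ≤ y ^ γ + y ^ γ / y := by linarith
      _ = _ := by field_simp
  rw [abs_le]
  constructor
  · have : y * y ^ γ / (y + 1) ≤ y * (y + 1) ^ γ / (y + 1) := by gcongr
    have h3 : y ^ γ - y * y ^ γ / (y + 1) ≤ y ^ γ / y := by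
      have : y ^ γ - y * y ^ γ / (y + 1) = y ^ γ / (y + 1) := by field_simp; ring
      rw [this]; gcongr; linarith
    have h4 : y * γ * ((y + 1) ^ γ / (y + 1)) - y ^ γ * γ =
        -(γ * (y ^ γ - y * (y + 1) ^ γ / (y + 1))) := by ring
    rw [h4, neg_le_neg_iff]
    calc γ * (y ^ γ - y * (y + 1) ^ γ / (y + 1)) ≤ γ * (y ^ γ / y) := by gcongr; linarith
      _ ≤ _ := mul_le_of_le_one_left (by positivity) hγ1
  · have h5 : y * γ * ((y + 1) ^ γ / (y + 1)) ≤ y * γ * (y ^ γ * ((y + 1) / y) / (y + 1)) := by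
      gcongr
    have h6 : y * γ * (y ^ γ * ((y + 1) / y) / (y + 1)) = y ^ γ * γ := by field_simp
    have : 0 < y ^ γ / y := by positivity
    linarith

theorem norm_e (x : ℝ) : ‖e x‖ = 1 := by
  rw [e, show 2 * Real.pi * Complex.I * x = ((2 * Real.pi * x : ℝ) : ℂ) * Complex.I by
    push_cast; ring, Complex.norm_exp_ofReal_mul_I]

theorem contDiff_e_exp (c t : ℝ) {n : WithTop ℕ∞} :
    ContDiff ℝ n fun v : ℝ ↦ e (t * Real.exp (c * v)) := by
  have h0 : ContDiff ℝ n fun v : ℝ ↦ t * Real.exp (c * v) := by fun_prop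
  have h1 : ContDiff ℝ n fun v : ℝ ↦ ((t * Real.exp (c * v) : ℝ) : ℂ) :=
    Complex.ofRealCLM.contDiff.comp h0
  unfold e
  exact (contDiff_const.mul h1).cexp

theorem norm_deriv_e_exp (hc : 0 ≤ c) (v : ℝ) :
    ‖deriv (fun v : ℝ ↦ e (t * Real.exp (c * v))) v‖ =
      2 * Real.pi * c * (|t| * Real.exp (c * v)) := by
  have h1 : HasDerivAt (fun v : ℝ ↦ t * Real.exp (c * v)) (t * (Real.exp (c * v) * c)) v := by
    simpa using (((hasDerivAt_id v).const_mul c).exp.const_mul t)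
  have h2 := (h1.ofReal_comp.const_mul (2 * Real.pi * Complex.I)).cexp
  rw [show deriv (fun v : ℝ ↦ e (t * Real.exp (c * v))) v = _ from h2.deriv, norm_mul]
  have h3 := norm_e (t * Real.exp (c * v))
  rw [e] at h3
  rw [h3, one_mul, norm_mul, norm_mul, norm_mul, Complex.norm_I, Complex.norm_real,
    Complex.norm_real, Complex.norm_two, Real.norm_eq_abs, Real.norm_eq_abs,
    abs_of_pos Real.pi_pos, abs_mul, abs_mul, abs_of_pos (Real.exp_pos _), abs_of_nonneg hc]
  ring

/-- The weight `((n + 1) ^ γ - n ^ γ) * e (t * n ^ c)` at `n = exp v`, smoothly cut off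
to `[a, b]`. -/
noncomputable def smoothWeight (a b Y γ c t v : ℝ) : ℂ :=
  (smoothCutoff a b Y v : ℂ) * ((rpowIncrement γ v : ℂ) * e (t * Real.exp (c * v)))

theorem contDiff_smoothWeight (a b Y γ c t : ℝ) :
    ContDiff ℝ (⊤ : ℕ∞) (smoothWeight a b Y γ c t) :=
  (Complex.ofRealCLM.contDiff.comp (contDiff_smoothCutoff a b Y)).mul
    ((Complex.ofRealCLM.contDiff.comp (contDiff_rpowIncrement γ)).mul (contDiff_e_exp c t))

theorem smoothWeight_eq_zero (hY : 0 ≤ Y) (hv : v ∉ Set.Icc a b) :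
    smoothWeight a b Y γ c t v = 0 := by
  rw [Set.mem_Icc, not_and_or, not_le, not_le] at hv
  rcases hv with hv | hv
  · rw [smoothWeight, smoothCutoff_eq_zero_of_le_left hY hv.le, Complex.ofReal_zero, zero_mul]
  · rw [smoothWeight, smoothCutoff_eq_zero_of_right_le hY hv.le, Complex.ofReal_zero, zero_mul]

theorem norm_rpowIncrement_mul_e_le (hγ0 : 0 ≤ γ) (hγ1 : γ ≤ 1) (hav : a ≤ v) (x : ℝ) :
    ‖(rpowIncrement γ v : ℂ) * e x‖ ≤ Real.exp ((γ - 1) * a) := by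
  rw [norm_mul, norm_e, mul_one, Complex.norm_real,
    Real.norm_of_nonneg (rpowIncrement_nonneg hγ0 v)]
  refine (rpowIncrement_le hγ0 hγ1 v).trans (Real.exp_le_exp.mpr ?_)
  nlinarith

theorem norm_smoothWeight_le (hγ0 : 0 ≤ γ) (hγ1 : γ ≤ 1) (hY : 0 ≤ Y) (v : ℝ) :
    ‖smoothWeight a b Y γ c t v‖ ≤ Real.exp ((γ - 1) * a) := by
  by_cases hv : v ∈ Set.Icc a b
  · rw [smoothWeight, norm_mul, Complex.norm_real, Real.norm_of_nonneg (smoothCutoff_nonneg ..)]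
    exact (mul_le_of_le_one_left (norm_nonneg _) (smoothCutoff_le_one ..)).trans
      (norm_rpowIncrement_mul_e_le hγ0 hγ1 hv.1 _)
  · rw [smoothWeight_eq_zero hY hv, norm_zero]; positivity

theorem norm_deriv_smoothWeight_le {A : ℝ} (hA : ∀ x, |deriv Real.smoothTransition x| ≤ A)
    (hγ0 : 0 ≤ γ) (hγ1 : γ ≤ 1) (hc : 0 ≤ c) (hY : 1 ≤ Y) (ht : |t| * Real.exp (c * b) ≤ Y)
    (v : ℝ) : ‖deriv (smoothWeight a b Y γ c t) v‖ ≤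
      (2 * A + 1 + 2 * Real.pi * c) * Real.exp ((γ - 1) * a) * Y := by
  have hY0 : 0 ≤ Y := by linarith
  have hA0 : 0 ≤ A := (abs_nonneg _).trans (hA 0)
  have hpi := Real.pi_pos
  by_cases hv : v ∈ Set.Icc a b
  · have d1 : HasDerivAt (fun v ↦ (smoothCutoff a b Y v : ℂ))
        (deriv (smoothCutoff a b Y) v : ℝ) v :=
      ((contDiff_smoothCutoff a b Y).differentiable (by simp) v).hasDerivAt.ofReal_comp
    have d2 : HasDerivAt (fun v ↦ (rpowIncrement γ v : ℂ)) (deriv (rpowIncrement γ) v : ℝ) v :=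
      ((contDiff_rpowIncrement γ (n := 1)).differentiable one_ne_zero v).hasDerivAt.ofReal_comp
    have d3 := ((contDiff_e_exp c t (n := 1)).differentiable one_ne_zero v).hasDerivAt
    have hWa : Real.exp ((γ - 1) * v) ≤ Real.exp ((γ - 1) * a) :=
      Real.exp_le_exp.mpr (by nlinarith [hv.1])
    have hw := norm_rpowIncrement_mul_e_le hγ0 hγ1 hv.1 (t * Real.exp (c * v))
    have hw2 := (rpowIncrement_le hγ0 hγ1 v).trans hWa
    have hd := (abs_deriv_rpowIncrement_le hγ0 hγ1 v).trans hWa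
    have hte : |t| * Real.exp (c * v) ≤ Y := by
      refine le_trans ?_ ht
      gcongr
      exact hv.2
    rw [show deriv (smoothWeight a b Y γ c t) v = _ from (d1.mul (d2.mul d3)).deriv]
    set W := Real.exp ((γ - 1) * a)
    have hW : 0 < W := Real.exp_pos _
    calc _ ≤ ‖((deriv (smoothCutoff a b Y) v : ℝ) : ℂ)‖ *
            ‖(rpowIncrement γ v : ℂ) * e (t * Real.exp (c * v))‖ +
          ‖(smoothCutoff a b Y v : ℂ)‖ * (‖((deriv (rpowIncrement γ) v : ℝ) : ℂ)‖ *
            ‖e (t * Real.exp (c * v))‖ + ‖(rpowIncrement γ v : ℂ)‖ *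
            ‖deriv (fun v : ℝ ↦ e (t * Real.exp (c * v))) v‖) := by
          refine (norm_add_le _ _).trans (add_le_add (norm_mul_le _ _) ?_)
          refine (norm_mul_le _ _).trans (mul_le_mul_of_nonneg_left ?_ (norm_nonneg _))
          exact (norm_add_le _ _).trans (add_le_add (norm_mul_le _ _) (norm_mul_le _ _))
      _ ≤ 2 * A * Y * W + 1 * (W * 1 + W * (2 * Real.pi * c * Y)) := by
          rw [norm_deriv_e_exp hc, norm_e, Complex.norm_real, Complex.norm_real,
            Complex.norm_real, Complex.norm_real, Real.norm_of_nonneg (smoothCutoff_nonneg ..),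
            Real.norm_of_nonneg (rpowIncrement_nonneg hγ0 v), Real.norm_eq_abs, Real.norm_eq_abs]
          have hw0 := rpowIncrement_nonneg hγ0 v
          gcongr
          exacts [abs_deriv_smoothCutoff_le hA a b hY0 v, smoothCutoff_le_one ..]
      _ ≤ 2 * A * Y * W + 1 * (W * Y + W * (2 * Real.pi * c * Y)) := by gcongr
      _ = _ := by ring
  · rw [deriv_eq_zero_of_notMem_Icc (fun v hv ↦ smoothWeight_eq_zero hY0 hv) v hv, norm_zero]
    positivity

theorem rpowIncrement_mul_e_log {n : ℕ} (hn : n ≠ 0) (γ c t : ℝ) :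
    (rpowIncrement γ (Real.log n) : ℂ) * e (t * Real.exp (c * Real.log n)) =
      ((((n : ℝ) + 1) ^ γ - (n : ℝ) ^ γ : ℝ) : ℂ) * e (t * (n : ℝ) ^ c) := by
  have hn0 : (0 : ℝ) < n := by positivity
  rw [rpowIncrement, Real.exp_log hn0, mul_comm γ, mul_comm c, ← Real.rpow_def_of_pos hn0,
    ← Real.rpow_def_of_pos hn0]

end Weight

/-! ### The exponential sum for a single character -/

section CharacterSum

theorem card_Ioc_floor_le {p q : ℝ} (hp : 0 ≤ p) (hpq : p ≤ q) :
    (#(Ioc ⌊p⌋₊ ⌊q⌋₊) : ℝ) ≤ q - p + 1 := by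
  rw [Nat.card_Ioc, Nat.cast_sub (Nat.floor_mono hpq)]
  linarith [Nat.floor_le (hp.trans hpq), Nat.lt_floor_add_one p]

/-- Few integers `n` have `log n` in the transition regions of `smoothCutoff`. -/
theorem card_filter_smoothCutoff_ne_one_le {p X Y : ℝ} (hp : 0 < p) (hpX : p ≤ X) (hY : 1 ≤ Y)
    (hYX : Y ≤ X) : (#{n ∈ Ioc ⌊p⌋₊ ⌊X⌋₊ |
      smoothCutoff (Real.log p) (Real.log X) Y (Real.log (n : ℕ)) ≠ 1} : ℝ) ≤ 6 * (X / Y) := by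
  have hX : 0 < X := hp.trans_le hpX
  have hY0 : 0 < Y := by linarith
  have hYi : Y⁻¹ ≤ 1 := inv_le_one_of_one_le₀ hY
  have hexp1 : Real.exp Y⁻¹ - 1 ≤ 2 * Y⁻¹ := by
    have := Real.abs_exp_sub_one_le (x := Y⁻¹) (by rwa [abs_of_pos (by positivity)])
    rw [abs_of_pos (by positivity : 0 < Y⁻¹)] at this
    exact (le_abs_self _).trans this
  have hexp2 : 1 - Real.exp (-Y⁻¹) ≤ Y⁻¹ := by linarith [Real.add_one_le_exp (-Y⁻¹)]
  have hsub : {n ∈ Ioc ⌊p⌋₊ ⌊X⌋₊ |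
      smoothCutoff (Real.log p) (Real.log X) Y (Real.log (n : ℕ)) ≠ 1} ⊆
      Ioc ⌊p⌋₊ ⌊p * Real.exp Y⁻¹⌋₊ ∪ Ioc ⌊X * Real.exp (-Y⁻¹)⌋₊ ⌊X⌋₊ := by
    intro n hn
    rw [mem_filter, mem_Ioc] at hn
    obtain ⟨⟨h1, h2⟩, h3⟩ := hn
    have hn0 : (0 : ℝ) < n := by exact_mod_cast (Nat.zero_le _).trans_lt h1
    rw [mem_union, mem_Ioc, mem_Ioc]
    by_contra! h
    have h4 := h.1 h1
    have h5 : n ≤ ⌊X * Real.exp (-Y⁻¹)⌋₊ := by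
      by_contra! h6
      exact absurd h2 (h.2 h6).not_ge
    refine h3 (smoothCutoff_eq_one hY0 ?_ ?_)
    · rw [Real.le_log_iff_exp_le hn0, Real.exp_add, Real.exp_log hp]
      exact ((Nat.floor_lt (by positivity)).mp h4).le
    · rw [Real.log_le_iff_le_exp hn0, sub_eq_add_neg, Real.exp_add, Real.exp_log hX]
      exact (Nat.le_floor_iff (by positivity)).mp h5
  have hXY : 1 ≤ X / Y := (one_le_div hY0).mpr hYX
  have hc1 := card_Ioc_floor_le hp.le
    (le_mul_of_one_le_right hp.le (Real.one_le_exp (by positivity : 0 ≤ Y⁻¹)))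
  have hc2 := card_Ioc_floor_le (by positivity)
    (mul_le_of_le_one_right hX.le (Real.exp_le_one_iff.mpr (by simp [hY0.le] : -Y⁻¹ ≤ 0)))
  have hcard := (card_le_card hsub).trans (card_union_le _ _)
  have hcard' : (#{n ∈ Ioc ⌊p⌋₊ ⌊X⌋₊ |
      smoothCutoff (Real.log p) (Real.log X) Y (Real.log (n : ℕ)) ≠ 1} : ℝ) ≤
      #(Ioc ⌊p⌋₊ ⌊p * Real.exp Y⁻¹⌋₊) + #(Ioc ⌊X * Real.exp (-Y⁻¹)⌋₊ ⌊X⌋₊) := by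
    exact_mod_cast hcard
  have h1 : p * (Real.exp Y⁻¹ - 1) ≤ X * (2 * Y⁻¹) := by
    gcongr
    linarith [Real.one_le_exp (by positivity : 0 ≤ Y⁻¹)]
  have h2 : X * (1 - Real.exp (-Y⁻¹)) ≤ X * Y⁻¹ := by gcongr
  have h3 : X / Y = X * Y⁻¹ := div_eq_mul_inv _ _
  nlinarith

theorem tsum_mul_smoothWeight_log (f : ℕ → ℂ) (h0 : f 0 = 0) {p X Y : ℝ} (hp : 0 < p)
    (hX : 0 < X) (hY : 0 ≤ Y) (γ c t : ℝ) :
    ∑' n : ℕ, f n * smoothWeight (Real.log p) (Real.log X) Y γ c t (Real.log n) =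
      ∑ n ∈ Ioc ⌊p⌋₊ ⌊X⌋₊,
        f n * smoothWeight (Real.log p) (Real.log X) Y γ c t (Real.log n) := by
  refine tsum_eq_sum fun n hn ↦ ?_
  rcases eq_or_ne n 0 with rfl | hn0
  · rw [h0, zero_mul]
  have hnpos : (0 : ℝ) < n := by positivity
  rw [mem_Ioc, not_and_or, not_lt, not_le] at hn
  rw [smoothWeight]
  rcases hn with hn | hn
  · rw [smoothCutoff_eq_zero_of_le_left hY, Complex.ofReal_zero, zero_mul, mul_zero]
    exact Real.log_le_log hnpos ((Nat.le_floor_iff hp.le).mp hn)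
  · rw [smoothCutoff_eq_zero_of_right_le hY, Complex.ofReal_zero, zero_mul, mul_zero]
    exact Real.log_le_log hX ((Nat.floor_lt hX.le).mp hn).le

theorem norm_sum_sub_tsum_smoothWeight_le {N : ℕ} (χ : DirichletCharacter ℂ N) {γ : ℝ} (hγ0 : 0 ≤ γ)
    (hγ1 : γ ≤ 1) (c t : ℝ) {p X Y : ℝ} (hp : 0 < p) (hpX : p ≤ X) (hY : 1 ≤ Y) (hYX : Y ≤ X) :
    ‖∑ n ∈ Ioc ⌊p⌋₊ ⌊X⌋₊, (ArithmeticFunction.vonMangoldt n : ℂ) * χ (n : ZMod N)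
        * ((((n : ℝ) + 1) ^ γ - (n : ℝ) ^ γ : ℝ) : ℂ) * e (t * (n : ℝ) ^ c) -
      ∑' n : ℕ, χ n * ArithmeticFunction.vonMangoldt n *
        smoothWeight (Real.log p) (Real.log X) Y γ c t (Real.log n)‖ ≤
      6 * (X / Y) * (Real.log X * Real.exp ((γ - 1) * Real.log p)) := by
  have hX : 0 < X := hp.trans_le hpX
  have hX1 : 1 ≤ X := hY.trans hYX
  rw [tsum_mul_smoothWeight_log (fun n ↦ χ n * ArithmeticFunction.vonMangoldt n) (by simp) hp hX
    (by linarith), ← sum_sub_distrib]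
  set φ : ℕ → ℝ := fun n ↦ smoothCutoff (Real.log p) (Real.log X) Y (Real.log n) with hφ
  have hterm (n : ℕ) (hn : n ∈ Ioc ⌊p⌋₊ ⌊X⌋₊) :
      (ArithmeticFunction.vonMangoldt n : ℂ) * χ (n : ZMod N)
        * ((((n : ℝ) + 1) ^ γ - (n : ℝ) ^ γ : ℝ) : ℂ) * e (t * (n : ℝ) ^ c) -
      χ n * ArithmeticFunction.vonMangoldt n *
        smoothWeight (Real.log p) (Real.log X) Y γ c t (Real.log n) =
      ((1 - φ n : ℝ) : ℂ) * (χ n * ArithmeticFunction.vonMangoldt n *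
        ((rpowIncrement γ (Real.log n) : ℂ) * e (t * Real.exp (c * Real.log n)))) := by
    rw [smoothWeight, mul_assoc (_ * _), ← rpowIncrement_mul_e_log (by
      have := (mem_Ioc.mp hn).1; lia), hφ]
    push_cast
    ring
  rw [sum_congr rfl hterm, ← sum_filter_add_sum_filter_not _ (fun n ↦ φ n ≠ 1),
    sum_eq_zero (s := filter (fun n ↦ ¬ φ n ≠ 1) _) fun n hn ↦ by
      rw [not_not.mp (mem_filter.mp hn).2, sub_self, Complex.ofReal_zero, zero_mul], add_zero]
  have hlX : 0 ≤ Real.log X := Real.log_nonneg hX1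
  refine (norm_sum_le_of_le _ (f := fun n ↦ ((1 - φ n : ℝ) : ℂ) * _)
    (n := fun _ ↦ Real.log X * Real.exp ((γ - 1) * Real.log p)) fun n hn ↦ ?_).trans ?_
  · obtain ⟨h1, h2⟩ := mem_Ioc.mp (mem_filter.mp hn).1
    have hn0 : (0 : ℝ) < n := by exact_mod_cast (Nat.zero_le _).trans_lt h1
    have hpn : Real.log p ≤ Real.log n := Real.log_le_log hp ((Nat.floor_lt hp.le).mp h1).le
    have hnX : Real.log n ≤ Real.log X := Real.log_le_log hn0 ((Nat.le_floor_iff hX.le).mp h2)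
    have hφ1 : |1 - φ n| ≤ 1 := abs_le.mpr
      ⟨by linarith [smoothCutoff_le_one (Real.log p) (Real.log X) Y (Real.log n)],
        by linarith [smoothCutoff_nonneg (Real.log p) (Real.log X) Y (Real.log n)]⟩
    have hΛ : ‖(ArithmeticFunction.vonMangoldt n : ℂ)‖ ≤ Real.log X := by
      rw [Complex.norm_real, Real.norm_of_nonneg ArithmeticFunction.vonMangoldt_nonneg]
      exact ArithmeticFunction.vonMangoldt_le_log.trans hnX
    have hχ : ‖χ (n : ZMod N)‖ ≤ 1 := χ.norm_le_one _
    have hw := norm_rpowIncrement_mul_e_le hγ0 hγ1 hpn (t * Real.exp (c * Real.log n))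
    rw [norm_mul, norm_mul (_ * _), norm_mul (χ _), Complex.norm_real, Real.norm_eq_abs]
    calc _ ≤ 1 * (1 * Real.log X * Real.exp ((γ - 1) * Real.log p)) := by gcongr
      _ = _ := by ring
  · rw [sum_const, nsmul_eq_mul]
    gcongr
    exact card_filter_smoothCutoff_ne_one_le hp hpX hY hYX

theorem GRH.exists_norm_sum_twist_le (hGRH : GRH) {ε γ c : ℝ} (hε : 0 < ε) (hε1 : ε ≤ 1)
    (hγ0 : 0 ≤ γ) (hγ1 : γ ≤ 1) (hc : 0 ≤ c) :
    ∃ M > 0, ∀ (N : ℕ) [NeZero N] (χ : DirichletCharacter ℂ N) (p X Y t : ℝ),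
      χ ≠ 1 → 0 < p → p ≤ X → 1 ≤ Y → Y ≤ X → |t| * X ^ c ≤ Y →
      ‖∑ n ∈ Ioc ⌊p⌋₊ ⌊X⌋₊, (ArithmeticFunction.vonMangoldt n : ℂ) * χ (n : ZMod N)
        * ((((n : ℝ) + 1) ^ γ - (n : ℝ) ^ γ : ℝ) : ℂ) * e (t * (n : ℝ) ^ c)‖ ≤
        M * p ^ (γ - 1) * ((Real.log (X / p) + 1) *
          (X ^ (1 / 2 + ε) * √Y * Real.log (40 * N * Y)) + X / Y * Real.log X) := by
  obtain ⟨M, hM0, hM⟩ := hGRH.exists_norm_tsum_twist_vonMangoldt_le hε hε1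
  obtain ⟨A, hA0, hA⟩ := exists_norm_deriv_smoothTransition_le
  have hpi := Real.pi_pos
  set κ : ℝ := 2 * A + 1 + 2 * Real.pi * c with hκ
  have hκ1 : 1 ≤ κ := by have : 0 ≤ Real.pi * c := by positivity
                         linarith
  refine ⟨M * κ + 6, by positivity, ?_⟩
  intro N _ χ p X Y t hχ hp hpX hY hYX ht
  have hX : 0 < X := hp.trans_le hpX
  have hX1 : 1 ≤ X := hY.trans hYX
  have hN : (1 : ℝ) ≤ N := by exact_mod_cast NeZero.one_le
  have hY0 : 0 ≤ Y := by linarith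
  have hlog : Real.log p ≤ Real.log X := Real.log_le_log hp hpX
  have hpow : Real.exp ((γ - 1) * Real.log p) = p ^ (γ - 1) := by
    rw [mul_comm, ← Real.rpow_def_of_pos hp]
  have ht' : |t| * Real.exp (c * Real.log X) ≤ Y := by
    rwa [mul_comm c, ← Real.rpow_def_of_pos hX]
  have h1 := hM N χ (smoothWeight (Real.log p) (Real.log X) Y γ c t) (Real.log p) (Real.log X)
    (κ * p ^ (γ - 1)) Y hχ (contDiff_smoothWeight ..) hlog (by positivity) hY
    (fun v hv ↦ smoothWeight_eq_zero hY0 hv)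
    (fun v ↦ (norm_smoothWeight_le hγ0 hγ1 hY0 v).trans (by
      rw [hpow]; exact le_mul_of_one_le_left (by positivity) hκ1))
    (fun v ↦ by rw [← hpow]; exact norm_deriv_smoothWeight_le hA hγ0 hγ1 hc hY ht' v)
  have h2 := norm_sum_sub_tsum_smoothWeight_le χ hγ0 hγ1 c t hp hpX hY hYX
  rw [hpow] at h2
  rw [mul_comm (1 / 2 + ε), ← Real.rpow_def_of_pos hX, ← Real.log_div hX.ne' hp.ne'] at h1
  have h3 : 0 ≤ Real.log (X / p) := Real.log_nonneg ((one_le_div hp).mpr hpX)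
  have h4 : 0 ≤ Real.log (40 * N * Y) := Real.log_nonneg (by nlinarith)
  have h5 : 0 ≤ Real.log X := Real.log_nonneg hX1
  set T := (Real.log (X / p) + 1) * (X ^ (1 / 2 + ε) * √Y * Real.log (40 * N * Y)) with hT
  have hT0 : 0 ≤ T := by positivity
  have hR0 : 0 ≤ X / Y * Real.log X := by positivity
  have hP : 0 < p ^ (γ - 1) := by positivity
  have h6 := norm_le_norm_add_norm_sub' (∑ n ∈ Ioc ⌊p⌋₊ ⌊X⌋₊,
    (ArithmeticFunction.vonMangoldt n : ℂ) * χ (n : ZMod N)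
      * ((((n : ℝ) + 1) ^ γ - (n : ℝ) ^ γ : ℝ) : ℂ) * e (t * (n : ℝ) ^ c))
    (∑' n : ℕ, χ n * ArithmeticFunction.vonMangoldt n *
        smoothWeight (Real.log p) (Real.log X) Y γ c t (Real.log n))
  refine h6.trans ((add_le_add h1 h2).trans ?_)
  calc _ = M * κ * p ^ (γ - 1) * T + 6 * p ^ (γ - 1) * (X / Y * Real.log X) := by rw [hT]; ring
    _ ≤ (M * κ + 6) * p ^ (γ - 1) * T + (M * κ + 6) * p ^ (γ - 1) * (X / Y * Real.log X) := by
      gcongr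
      · linarith
      · have : 0 < M * κ := by positivity
        linarith
    _ = _ := by ring

end CharacterSum

section Average

theorem GRH.exists_norm_sum_twist_le_rpow (hGRH : GRH) {μ γ c δ : ℝ} (hμ0 : 0 < μ) (hμ1 : μ ≤ 1)
    (hγ0 : 0 ≤ γ) (hγ1 : γ ≤ 1) (hc : 0 ≤ c) (hδ : 0 < δ) (hδ1 : δ ≤ 1 / 2) :
    ∃ M > 0, ∀ (N : ℕ) [NeZero N] (χ : DirichletCharacter ℂ N) (X t : ℝ),
      χ ≠ 1 → 40 ≤ X → N ≤ X → |t| * X ^ c ≤ X ^ (1 - δ) →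
      ‖∑ n ∈ Ioc ⌊μ * X⌋₊ ⌊X⌋₊, (ArithmeticFunction.vonMangoldt n : ℂ) * χ (n : ZMod N)
        * ((((n : ℝ) + 1) ^ γ - (n : ℝ) ^ γ : ℝ) : ℂ) * e (t * (n : ℝ) ^ c)‖ ≤
        M * (X ^ (γ - δ / 4) * Real.log X) := by
  obtain ⟨M, hM0, hM⟩ := hGRH.exists_norm_sum_twist_le (ε := δ / 4) (by linarith) (by linarith)
    hγ0 hγ1 hc
  have hl : 0 ≤ Real.log (1 / μ) := Real.log_nonneg ((one_le_div hμ0).mpr hμ1)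
  refine ⟨M * μ ^ (γ - 1) * ((Real.log (1 / μ) + 1) * 3 + 1), by positivity, ?_⟩
  intro N _ χ X t hχ hX40 hNX ht
  have hX0 : 0 < X := by linarith
  have hX1 : 1 ≤ X := by linarith
  have hN : (1 : ℝ) ≤ N := by exact_mod_cast NeZero.one_le
  have hlX : 0 ≤ Real.log X := Real.log_nonneg hX1
  have hY1 : 1 ≤ X ^ (1 - δ) := Real.one_le_rpow hX1 (by linarith)
  have hYX : X ^ (1 - δ) ≤ X := Real.rpow_le_self_of_one_le hX1 (by linarith)
  refine (hM N χ (μ * X) X (X ^ (1 - δ)) t hχ (by positivity) (mul_le_of_le_one_left hX0.le hμ1)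
    hY1 hYX ht).trans ?_
  have h1 : X / (μ * X) = 1 / μ := by field_simp
  have h2 : X ^ (1 / 2 + δ / 4) * √(X ^ (1 - δ)) = X ^ (1 - δ / 4) := by
    rw [Real.sqrt_eq_rpow, ← Real.rpow_mul hX0.le, ← Real.rpow_add hX0]
    ring_nf
  have h3 : Real.log (40 * N * X ^ (1 - δ)) ≤ 3 * Real.log X := by
    calc _ ≤ Real.log (X * X * X) := Real.log_le_log (by positivity) (by gcongr)
      _ = _ := by
        rw [Real.log_mul (by positivity) (by positivity), Real.log_mul (by positivity)
          (by positivity)]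
        ring
  have h4 : X / X ^ (1 - δ) ≤ X ^ (1 - δ / 4) := by
    rw [div_eq_mul_inv, ← Real.rpow_neg hX0.le]
    nth_rewrite 1 [← Real.rpow_one X]
    rw [← Real.rpow_add hX0]
    exact Real.rpow_le_rpow_of_exponent_le hX1 (by linarith)
  have h5 : X ^ (γ - δ / 4) = X ^ (γ - 1) * X ^ (1 - δ / 4) := by
    rw [← Real.rpow_add hX0]; ring_nf
  rw [h1, h2, Real.mul_rpow hμ0.le hX0.le, h5]
  calc _ ≤ M * (μ ^ (γ - 1) * X ^ (γ - 1)) * ((Real.log (1 / μ) + 1) *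
        (X ^ (1 - δ / 4) * (3 * Real.log X)) + X ^ (1 - δ / 4) * Real.log X) := by gcongr
    _ = _ := by ring

theorem DirichletCharacter.IsPrimitive.ne_one {q : ℕ} (hq : 1 < q) {χ : DirichletCharacter ℂ q}
    (hχ : χ.IsPrimitive) : χ ≠ 1 := by
  have : NeZero q := ⟨by lia⟩
  rintro rfl
  rw [DirichletCharacter.isPrimitive_def, DirichletCharacter.conductor_one] at hχ
  lia

theorem sum_Ioc_average_le {x T : ℝ} (hx : 0 ≤ x) (hT : 0 ≤ T)
    (f : (q : ℕ) → DirichletCharacter ℂ q → ℝ)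
    (hf : ∀ q : ℕ, 1 < q → (q : ℝ) ≤ x → ∀ χ : DirichletCharacter ℂ q, f q χ ≤ T) :
    ∑ q ∈ Ioc 1 ⌊x⌋₊, (1 / (Nat.totient q : ℝ)) * ∑ χ : DirichletCharacter ℂ q, f q χ ≤
      x * T := by
  calc _ ≤ ∑ q ∈ Ioc 1 ⌊x⌋₊, T := by
        refine sum_le_sum fun q hq ↦ ?_
        obtain ⟨h1, h2⟩ := mem_Ioc.mp hq
        have : NeZero q := ⟨by lia⟩
        have hφ : (0 : ℝ) < Nat.totient q := by exact_mod_cast Nat.totient_pos.mpr (by lia)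
        have hcard : Fintype.card (DirichletCharacter ℂ q) = Nat.totient q := by
          rw [← Nat.card_eq_fintype_card,
            DirichletCharacter.card_eq_totient_of_hasEnoughRootsOfUnity]
        have := sum_le_card_nsmul univ (f q) T
          fun χ _ ↦ hf q h1 ((Nat.le_floor_iff hx).mp h2) χ
        rw [card_univ, hcard, nsmul_eq_mul] at this
        rw [one_div_mul_eq_div, div_le_iff₀ hφ]
        linarith
    _ = (⌊x⌋₊ - 1 : ℕ) * T := by rw [sum_const, Nat.card_Ioc, nsmul_eq_mul]
    _ ≤ x * T := by
      gcongr
      exact (Nat.cast_le.mpr (Nat.sub_le _ _)).trans (Nat.floor_le hx)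

end Average

/-- Under GRH, bound on the average over primitive characters of exponential sums of
`Λ(n) χ(n) ((n+1)^γ - n^γ) e(t n^c)`. -/
theorem avg_primitive_char_gamma_difference_exponential (hGRH : GRH) (μ γ c B C : ℝ)
    (hμ0 : 0 < μ) (hμ1 : μ < 1) (hγ1 : (2 : ℝ) / 5 < γ) (hγ2 : γ < 1)
    (hc1 : 1 < c) (hc3 : c < 3) (hc2 : c ≠ 2) (hB : 0 < B) (hC : 0 < C) :
    ∃ δ₀ > 0, ∀ δ : ℝ, 0 < δ → δ ≤ δ₀ →
      ∃ K > 0, ∃ X₀ : ℝ, ∀ X : ℝ, X₀ ≤ X →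
        ∀ t : ℝ, |t| ≤ X ^ ((4 * γ - 3 * c - 1) / 3 - δ) →
          ∑ q ∈ Ioc 1 ⌊Real.log X ^ C⌋₊, (1 / (Nat.totient q : ℝ)) *
              ∑ χ : DirichletCharacter ℂ q,
                (if χ.IsPrimitive then
                  ‖∑ n ∈ Ioc ⌊μ * X⌋₊ ⌊X⌋₊,
                      (ArithmeticFunction.vonMangoldt n : ℂ) * χ (n : ZMod q)
                        * ((((n : ℝ) + 1) ^ γ - (n : ℝ) ^ γ : ℝ) : ℂ)
                        * e (t * (n : ℝ) ^ c)‖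
                else 0)
            ≤ K * (X ^ γ / Real.log X ^ B) := by
  refine ⟨1 / 2, by norm_num, fun δ hδ hδ1 ↦ ?_⟩
  obtain ⟨M, hM0, hM⟩ := hGRH.exists_norm_sum_twist_le_rpow hμ0 hμ1.le (γ := γ) (c := c)
    (by linarith) hγ2.le (by linarith) hδ hδ1
  have hlog1 := (isLittleO_log_rpow_rpow_atTop C one_pos).bound one_pos
  have hlog2 := (isLittleO_log_rpow_rpow_atTop (C + 1 + B) (by positivity : 0 < δ / 4)).bound one_pos
  obtain ⟨X₁, hX₁⟩ := Filter.eventually_atTop.mp (hlog1.and hlog2)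
  refine ⟨M, hM0, max X₁ 40, fun X hX t ht ↦ ?_⟩
  obtain ⟨hl1, hl2⟩ := hX₁ X ((le_max_left _ _).trans hX)
  have hX40 : 40 ≤ X := (le_max_right _ _).trans hX
  have hX0 : 0 < X := by linarith
  have hL : 0 < Real.log X := Real.log_pos (by linarith)
  rw [Real.norm_of_nonneg (by positivity), Real.norm_of_nonneg (by positivity), one_mul] at hl1 hl2
  rw [Real.rpow_one] at hl1
  have htX : |t| * X ^ c ≤ X ^ (1 - δ) := by
    calc |t| * X ^ c ≤ X ^ ((4 * γ - 3 * c - 1) / 3 - δ) * X ^ c := by gcongr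
      _ = X ^ ((4 * γ - 1) / 3 - δ) := by rw [← Real.rpow_add hX0]; ring_nf
      _ ≤ X ^ (1 - δ) := Real.rpow_le_rpow_of_exponent_le (by linarith) (by linarith)
  refine (sum_Ioc_average_le (T := M * (X ^ (γ - δ / 4) * Real.log X)) (by positivity)
    (by positivity) _ fun q hq1 hq χ ↦ ?_).trans ?_
  · have : NeZero q := ⟨by lia⟩
    split_ifs with hχ
    · exact hM q χ X t (hχ.ne_one hq1) hX40 (hq.trans hl1) htX
    · positivity
  · rw [← mul_div_assoc, le_div_iff₀ (by positivity)]
    calc Real.log X ^ C * (M * (X ^ (γ - δ / 4) * Real.log X)) * Real.log X ^ B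
        = M * (X ^ (γ - δ / 4) * Real.log X ^ (C + 1 + B)) := by
          rw [Real.rpow_add hL, Real.rpow_add hL, Real.rpow_one]; ring
      _ ≤ M * (X ^ (γ - δ / 4) * X ^ (δ / 4)) := by gcongr
      _ = M * X ^ γ := by rw [← Real.rpow_add hX0]; ring_nf
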